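/- arXiv:1408.2728 — 16 statements merged into one kernel-verified Lean document; each statement's English description precedes it below -/
import Mathlib

section
/- Let ℓ ≥ 1 and let R be a set of positive integers. Then R is a set of ℓ-recurrence if and only if for every r ≥ 1 and every partition ℕ = C₁ ∪ ⋯ ∪ C_r of the positive integers into finitely many cells, there is some cell C_j containing an arithmetic progression of length ℓ+1 whose common difference belongs to R. -/
/-- A system `(X,T)` is minimal if no nonempty proper closed subset `K` satisfies `T(K) = K`. -/
def IsMinimal {X : Type} [TopologicalSpace X] (T : X → X) : Prop :=
  ∀ K : Set X, IsClosed K → K.Nonempty → T '' K = K → K = Set.univ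

/-- `N^ℓ(U) = {n ≥ 1 : U ∩ T⁻ⁿU ∩ T⁻²ⁿU ∩ ⋯ ∩ T^{-ℓn}U ≠ ∅}`. -/
def RetTimes {X : Type} (T : X → X) (ℓ : ℕ) (U : Set X) : Set ℕ :=
  {n | 1 ≤ n ∧ ∃ x, ∀ j ≤ ℓ, T^[j * n] x ∈ U}

/-- `R` is a set of `ℓ`-recurrence: for every minimal system `(X,T)` on a compact metric
space and every nonempty open `U ⊆ X` there exists `n ∈ R` with `n ∈ N^ℓ(U)`. -/
def IsRecSet (ℓ : ℕ) (R : Set ℕ) : Prop :=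
  ∀ (X : Type) [MetricSpace X] [CompactSpace X] (T : X ≃ₜ X),
    IsMinimal (⇑T) → ∀ U : Set X, IsOpen U → U.Nonempty →
      ∃ n ∈ R, n ∈ RetTimes (⇑T) ℓ U

open Filter Topology

theorem homeomorph_iterate_eq_zpow {X : Type*} [TopologicalSpace X] (T : X ≃ₜ X) (k : ℕ) (x : X) :
    T^[k] x = (T ^ (k : ℤ)) x := by
  induction k generalizing x with
  | zero => rfl
  | succ k ih =>
    rw [Function.iterate_succ_apply, ih, Nat.cast_succ, zpow_add_one]
    rfl

/-- In a minimal system, finitely many translates of a nonempty open set cover the space. -/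
theorem IsMinimal.exists_finset_cover {X : Type} [TopologicalSpace X] [CompactSpace X]
    {T : X ≃ₜ X} (hT : IsMinimal T) {U : Set X} (hU : IsOpen U) (hne : U.Nonempty) :
    ∃ t : Finset ℤ, ∀ x, ∃ i ∈ t, (T ^ i) x ∈ U := by
  have hopen : ∀ i : ℤ, IsOpen ((T ^ i) ⁻¹' U) := fun i => hU.preimage (T ^ i).continuous
  have hcover : ∀ x, ∃ i : ℤ, (T ^ i) x ∈ U := by
    by_contra! hx
    have hK := hT (⋃ i : ℤ, (T ^ i) ⁻¹' U)ᶜ (isOpen_iUnion hopen).isClosed_compl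
      (by simpa [Set.Nonempty] using hx) (by
        rw [T.image_eq_preimage_symm]
        ext x
        simp only [Set.mem_preimage, Set.mem_compl_iff, Set.mem_iUnion, not_exists]
        have key : ∀ i : ℤ, (T ^ i) (T.symm x) = (T ^ (i - 1)) x := fun i => by
          rw [zpow_sub_one]
          rfl
        refine ⟨fun h i => ?_, fun h i => ?_⟩
        · simpa [key] using h (i + 1)
        · simpa [key] using h (i - 1))
    obtain ⟨u, hu⟩ := hne
    have : u ∈ (⋃ i : ℤ, (T ^ i) ⁻¹' U)ᶜ := hK ▸ Set.mem_univ u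
    exact this (Set.mem_iUnion.2 ⟨0, by simpa using hu⟩)
  obtain ⟨t, ht⟩ := isCompact_univ.elim_finite_subcover _ hopen
    (fun x _ => Set.mem_iUnion.2 (hcover x))
  exact ⟨t, fun x => by simpa using ht (Set.mem_univ x)⟩

/-- Every nonempty closed invariant set of a homeomorphism of a compact space contains a
minimal one. -/
theorem exists_minimal_closed_invariant {X : Type*} [TopologicalSpace X] [CompactSpace X]
    (S : X ≃ₜ X) {A : Set X} (hA : IsClosed A) (hne : A.Nonempty) (hinv : S ⁻¹' A = A) :
    ∃ Y ⊆ A, Minimal (fun K : Set X => IsClosed K ∧ K.Nonempty ∧ S ⁻¹' K = K) Y := by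
  refine zorn_superset_nonempty {K : Set X | IsClosed K ∧ K.Nonempty ∧ S ⁻¹' K = K}
    (fun c hc hchain hcne => ⟨⋂₀ c, ⟨isClosed_sInter fun K hK => (hc hK).1, ?_, ?_⟩,
      fun K hK => Set.sInter_subset_of_mem hK⟩) A ⟨hA, hne, hinv⟩
  · have : Nonempty c := hcne.to_subtype
    exact IsCompact.nonempty_sInter_of_directed_nonempty_isCompact_isClosed
      (fun K hK L hL => (hchain.total hK hL).elim (fun hKL => ⟨K, hK, subset_rfl, hKL⟩)
        fun hLK => ⟨L, hL, hLK, subset_rfl⟩) (fun K hK => (hc hK).2.1)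
      (fun K hK => (hc hK).1.isCompact) (fun K hK => (hc hK).1)
  · ext x
    simp only [Set.mem_preimage, Set.mem_sInter]
    exact forall₂_congr fun K hK => Set.ext_iff.1 (hc hK).2.2 x

theorem isMinimal_subtype {X : Type} [TopologicalSpace X] (S : X ≃ₜ X) {Y : Set X}
    (hY : Minimal (fun K : Set X => IsClosed K ∧ K.Nonempty ∧ S ⁻¹' K = K) Y)
    (hS : ∀ x, x ∈ Y ↔ S x ∈ Y) : IsMinimal (S.subtype hS) := by
  intro K hK hKne hKinv
  have himage : S '' (Subtype.val '' K) = Subtype.val '' K := by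
    conv_rhs => rw [← hKinv]
    rw [Set.image_image, Set.image_image]
    rfl
  have hpre : S ⁻¹' (Subtype.val '' K) = Subtype.val '' K := by
    conv_lhs => rw [← himage]
    exact S.preimage_image _
  have hle := hY.2 ⟨hY.1.1.isClosedEmbedding_subtypeVal.isClosedMap K hK, hKne.image _, hpre⟩
    (Subtype.coe_image_subset Y K)
  refine Set.eq_univ_of_forall fun y => ?_
  obtain ⟨z, hz, hzy⟩ := hle y.2
  exact Subtype.ext hzy ▸ hz

/-- The left shift on bi-infinite sequences. -/
def shift (α : Type*) [TopologicalSpace α] : (ℤ → α) ≃ₜ (ℤ → α) where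
  toFun x i := x (i + 1)
  invFun x i := x (i - 1)
  left_inv x := by simp
  right_inv x := by simp
  continuous_toFun := by fun_prop
  continuous_invFun := by fun_prop

theorem shift_iterate_apply {α : Type*} [TopologicalSpace α] (k : ℕ) (x : ℤ → α) (i : ℤ) :
    (shift α)^[k] x i = x (i + k) := by
  induction k generalizing x with
  | zero => simp
  | succ k ih =>
    rw [Function.iterate_succ_apply, ih]
    change x (i + k + 1) = _
    push_cast
    rw [add_assoc]

theorem preimage_mapClusterPt_of_semiconj {X : Type*} [TopologicalSpace X] (S : X ≃ₜ X)
    {z : ℕ → X} (hz : ∀ N, z (N + 1) = S (z N)) :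
    S ⁻¹' {x | MapClusterPt x atTop z} = {x | MapClusterPt x atTop z} := by
  have hcomp : ∀ x, MapClusterPt x atTop z ↔ MapClusterPt x atTop (S ∘ z) := by
    intro x
    have hSz : S ∘ z = z ∘ (· + 1) := funext fun N => (hz N).symm
    rw [hSz, MapClusterPt, MapClusterPt, ← Filter.map_map, map_add_atTop_eq_nat]
  ext x
  simp only [Set.mem_preimage, Set.mem_ofPred_eq]
  refine ⟨fun h => ?_, fun h => (hcomp _).2 (h.continuousAt_comp S.continuous.continuousAt)⟩
  have := ((hcomp _).1 h).continuousAt_comp S.symm.continuous.continuousAt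
  simpa [← Function.comp_assoc] using this

theorem exists_progression_of_isRecSet {ℓ : ℕ} {R : Set ℕ} (h : IsRecSet ℓ R) {r : ℕ}
    (C : ℕ → Fin r) : ∃ a n : ℕ, 1 ≤ a ∧ n ∈ R ∧ ∀ j ≤ ℓ, C (a + j * n) = C a := by
  let S := shift (Fin r)
  let z : ℕ → ℤ → Fin r := fun N i => C (N + i).toNat
  have hz : ∀ N, z (N + 1) = S (z N) := by
    intro N
    funext i
    change C _ = C _
    congr 2
    push_cast
    ring
  have hne : {x | MapClusterPt x atTop z}.Nonempty := by
    have : Nonempty (ℤ → Fin r) := ⟨z 0⟩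
    exact exists_clusterPt_of_compactSpace (Filter.map z atTop)
  obtain ⟨Y, hYA, hY⟩ := exists_minimal_closed_invariant S isClosed_setOfPred_clusterPt hne
    (preimage_mapClusterPt_of_semiconj S hz)
  have hSY : ∀ x, x ∈ Y ↔ S x ∈ Y := fun x => (Set.ext_iff.1 hY.1.2.2 x).symm
  let := TopologicalSpace.metrizableSpaceMetric (ℤ → Fin r)
  have : CompactSpace Y := isCompact_iff_compactSpace.1 hY.1.1.isCompact
  obtain ⟨y, hy⟩ := hY.1.2.1
  have hcont : Continuous fun x : Y => x.1 0 := (continuous_apply 0).comp continuous_subtype_val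
  obtain ⟨n, hnR, -, x, hx⟩ := h Y (S.subtype hSY) (isMinimal_subtype S hY hSY)
    {x | x.1 0 = y 0} ((isOpen_discrete {y 0}).preimage hcont) ⟨⟨y, hy⟩, rfl⟩
  have hval : ∀ k : ℕ, ((S.subtype hSY)^[k] x).1 = S^[k] x.1 := by
    intro k
    exact Function.Semiconj.iterate_right (f := Subtype.val) (fun _ => rfl) k x
  have hxj : ∀ j ≤ ℓ, x.1 ((j * n : ℕ) : ℤ) = y 0 := by
    intro j hj
    have h0 : ((S.subtype hSY)^[j * n] x).1 0 = y 0 := hx j hj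
    rw [hval] at h0
    simpa [S, shift_iterate_apply] using h0
  have hnhds : ∀ᶠ w in 𝓝 x.1, ∀ j ∈ Set.Iic ℓ, w ((j * n : ℕ) : ℤ) = y 0 := by
    rw [eventually_all_finite (Set.finite_Iic ℓ)]
    exact fun j hj => (continuous_apply ((j * n : ℕ) : ℤ)).continuousAt.eventually
      ((isOpen_discrete {y 0}).mem_nhds (hxj j hj))
  have hfreq : ∃ᶠ N in atTop, ∀ j ∈ Set.Iic ℓ, z N ((j * n : ℕ) : ℤ) = y 0 :=
    (hYA x.2 : MapClusterPt x.1 atTop z).frequently hnhds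
  obtain ⟨a, hza, ha⟩ := (hfreq.and_eventually (eventually_ge_atTop 1)).exists
  have hC : ∀ j ≤ ℓ, C (a + j * n) = y 0 := by
    intro j hj
    have := hza j hj
    simpa only [z, ← Nat.cast_add, Int.toNat_natCast] using this
  exact ⟨a, n, ha, hnR, fun j hj => by simpa [hC j hj] using (hC 0 ℓ.zero_le).symm⟩

theorem isRecSet_of_exists_progression {ℓ : ℕ} {R : Set ℕ} (hR : ∀ n ∈ R, 1 ≤ n)
    (h : ∀ r : ℕ, 1 ≤ r → ∀ C : ℕ → Fin r,
      ∃ a n : ℕ, 1 ≤ a ∧ n ∈ R ∧ ∀ j ≤ ℓ, C (a + j * n) = C a) :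
    IsRecSet ℓ R := by
  intro X _ _ T hT U hU hne
  obtain ⟨t, ht⟩ := hT.exists_finset_cover hU hne
  obtain ⟨x, -⟩ := hne
  choose i hit hiU using fun n : ℕ => ht ((T ^ (n : ℤ)) x)
  obtain ⟨a, n, -, hnR, hC⟩ := h t.card (Finset.card_pos.2 ⟨i 0, hit 0⟩)
    (fun n => t.equivFin ⟨i n, hit n⟩)
  refine ⟨n, hnR, hR n hnR, (T ^ (i a + a)) x, fun j hj => ?_⟩
  have hij : i (a + j * n) = i a := by simpa using hC j hj
  have hmem := hiU (a + j * n)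
  rw [hij, ← Homeomorph.mul_apply, ← zpow_add] at hmem
  rw [homeomorph_iterate_eq_zpow, ← Homeomorph.mul_apply, ← zpow_add]
  convert hmem using 3
  push_cast
  ring

/-- `R` is a set of `ℓ`-recurrence iff for every finite partition (coloring) of the positive
integers, some cell contains an arithmetic progression of length `ℓ+1` with common
difference in `R`. -/
theorem rec_iff_partition (ℓ : ℕ) (hℓ : 1 ≤ ℓ) (R : Set ℕ) (hR : ∀ n ∈ R, 1 ≤ n) :
    IsRecSet ℓ R ↔
      ∀ r : ℕ, 1 ≤ r → ∀ C : ℕ → Fin r,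
        ∃ a n : ℕ, 1 ≤ a ∧ n ∈ R ∧ ∀ j ≤ ℓ, C (a + j * n) = C a := by
  exact ⟨fun h _ _ C => exists_progression_of_isRecSet h C, isRecSet_of_exists_progression hR⟩
end

section
/- Let ℓ ≥ 1 and let R be a set of positive integers. Then R is a set of ℓ-recurrence if and only if every syndetic set E of positive integers contains an arithmetic progression of length ℓ+1 whose common difference belongs to R. -/
/-- A set `E` of positive integers is syndetic if there is `r ≥ 1` such that every interval
of `r` consecutive positive integers meets `E`. -/
def SyndeticPos (E : Set ℕ) : Prop :=
  ∃ r : ℕ, 1 ≤ r ∧ ∀ a : ℕ, 1 ≤ a → ∃ m ∈ E, a ≤ m ∧ m < a + r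

open Set Filter Topology

/-- In a minimal compact system, a nonempty closed forward invariant set is everything. -/
theorem IsMinimal.eq_univ_of_mapsTo {X : Type} [TopologicalSpace X] [T2Space X] [CompactSpace X]
    {T : X ≃ₜ X} (hT : IsMinimal T) {K : Set X} (hK : IsClosed K) (hne : K.Nonempty)
    (hTK : MapsTo T K K) : K = univ := by
  have hanti : Antitone fun n : ℕ => T^[n] '' K := by
    refine antitone_nat_of_succ_le fun n => ?_
    rintro _ ⟨x, hx, rfl⟩
    exact ⟨T x, hTK hx, rfl⟩
  have hcomp (n : ℕ) : IsCompact (T^[n] '' K) :=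
    hK.isCompact.image (T.continuous.iterate n)
  have hinter : (⋂ n : ℕ, T^[n] '' K) = univ := by
    refine hT _ (isClosed_iInter fun n => (hcomp n).isClosed) ?_ ?_
    · exact IsCompact.nonempty_iInter_of_directed_nonempty_isCompact_isClosed _
        hanti.directed_ge (fun n => hne.image _) hcomp fun n => (hcomp n).isClosed
    · rw [image_iInter T.bijective]
      have h (n : ℕ) : T '' (T^[n] '' K) = T^[n + 1] '' K := by
        rw [Function.iterate_succ', image_comp]
      simp only [h]
      exact hanti.iInf_nat_add 1
  refine eq_univ_of_univ_subset ?_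
  rw [← hinter]
  exact (iInter_subset _ 0).trans (by simp)

/-- In a minimal compact system, every orbit segment of some fixed length meets a given nonempty
open set. -/
theorem IsMinimal.exists_forall_exists_iterate_mem {X : Type} [TopologicalSpace X] [T2Space X]
    [CompactSpace X] {T : X ≃ₜ X} (hT : IsMinimal T) {U : Set X} (hU : IsOpen U)
    (hne : U.Nonempty) : ∃ N : ℕ, ∀ x, ∃ n < N, T^[n] x ∈ U := by
  have hopen (n : ℕ) : IsOpen (T^[n] ⁻¹' U) := hU.preimage (T.continuous.iterate n)
  have hcover : (⋃ n : ℕ, T^[n] ⁻¹' U) = univ := by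
    by_contra hcon
    have hK := hT.eq_univ_of_mapsTo (isOpen_iUnion hopen).isClosed_compl
      (nonempty_compl.2 hcon) (fun x hx => by
        simp only [mem_compl_iff, mem_iUnion, mem_preimage, not_exists] at hx ⊢
        exact fun n => hx (n + 1))
    obtain ⟨u, hu⟩ := hne
    have hu' : u ∈ (⋃ n : ℕ, T^[n] ⁻¹' U)ᶜ := hK ▸ mem_univ u
    exact hu' (mem_iUnion.2 ⟨0, hu⟩)
  obtain ⟨t, ht⟩ := isCompact_univ.elim_finite_subcover _ hopen hcover.ge
  refine ⟨t.sup id + 1, fun x => ?_⟩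
  obtain ⟨n, hn, hx⟩ := mem_iUnion₂.1 (ht (mem_univ x))
  exact ⟨n, Nat.lt_succ_of_le (Finset.le_sup (f := id) hn), hx⟩

/-- A nonempty closed invariant set of a compact system contains a minimal subsystem. -/
theorem exists_isMinimal_subtype {X : Type} [TopologicalSpace X] [CompactSpace X]
    (T : X ≃ₜ X) {Y : Set X} (hY : IsClosed Y) (hne : Y.Nonempty)
    (hTY : ∀ x, x ∈ Y ↔ T x ∈ Y) :
    ∃ M : Set X, M ⊆ Y ∧ IsClosed M ∧ M.Nonempty ∧
      ∃ hTM : ∀ x, x ∈ M ↔ T x ∈ M, IsMinimal (T.subtype hTM) := by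
  obtain ⟨M, hMY, hM⟩ := zorn_superset_nonempty
    {K : Set X | IsClosed K ∧ K.Nonempty ∧ ∀ x, x ∈ K ↔ T x ∈ K}
    (fun c hc hchain hcne => by
      refine ⟨⋂₀ c, ⟨isClosed_sInter fun K hK => (hc hK).1, ?_, fun x => ?_⟩,
        fun K hK => sInter_subset_of_mem hK⟩
      · have := hcne.to_subtype
        exact IsCompact.nonempty_sInter_of_directed_nonempty_isCompact_isClosed
          (fun K hK L hL => (hchain.total hK hL).elim
            (fun h => ⟨K, hK, subset_rfl, h⟩) fun h => ⟨L, hL, h, subset_rfl⟩) (fun K hK => (hc hK).2.1) (fun K hK => (hc hK).1.isCompact)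
          (fun K hK => (hc hK).1)
      · simp only [mem_sInter]
        exact forall₂_congr fun K hK => (hc hK).2.2 x) Y ⟨hY, hne, hTY⟩
  obtain ⟨hMc, hMne, hTM⟩ := hM.prop
  refine ⟨M, hMY, hMc, hMne, hTM, fun K hK hKne hTK => ?_⟩
  have hsub : Subtype.val '' K ⊆ M := by
    rintro _ ⟨x, -, rfl⟩
    exact x.2
  have hle := hM.le_of_le (y := Subtype.val '' K)
    ⟨hMc.isClosedEmbedding_subtypeVal.isClosedMap _ hK, hKne.image _, fun x => ?_⟩ hsub
  · refine eq_univ_of_forall fun x => ?_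
    obtain ⟨y, hy, hyx⟩ := hle x.2
    rwa [← Subtype.ext hyx]
  · constructor
    · rintro ⟨y, hy, rfl⟩
      exact ⟨T.subtype hTM y, hTK ▸ mem_image_of_mem _ hy, rfl⟩
    · rintro ⟨z, hz, hzx⟩
      rw [← hTK] at hz
      obtain ⟨y, hy, rfl⟩ := hz
      exact ⟨y, hy, T.injective hzx⟩

/-- The shift on two-sided binary sequences. -/
def binaryShift : (ℤ → Bool) ≃ₜ (ℤ → Bool) where
  toFun y i := y (i + 1)
  invFun y i := y (i - 1)
  left_inv y := by simp
  right_inv y := by simp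
  continuous_toFun := by fun_prop
  continuous_invFun := by fun_prop

theorem binaryShift_apply (y : ℤ → Bool) (i : ℤ) : binaryShift y i = y (i + 1) :=
  rfl

/-- The two-sided binary sequences which meet every window of length `r`, and all of whose finite
patterns of ones occur, up to translation, in `E`. -/
def patternSpace (E : Set ℕ) (r : ℕ) : Set (ℤ → Bool) :=
  {y | (∀ k : ℤ, ∃ j < r, y (k + j) = true) ∧
    ∀ F : Finset ℤ, (∀ i ∈ F, y i = true) → ∃ a : ℤ, ∀ i ∈ F, ∃ m ∈ E, (m : ℤ) = a + i}

theorem isClosed_patternSpace (E : Set ℕ) (r : ℕ) : IsClosed (patternSpace E r) := by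
  have hclopen (i : ℤ) : IsClopen {y : ℤ → Bool | y i = true} :=
    (isClopen_discrete {true}).preimage (continuous_apply i)
  refine IsClosed.inter (s₁ := {y : ℤ → Bool | ∀ k : ℤ, ∃ j < r, y (k + j) = true})
    (s₂ := {y : ℤ → Bool | ∀ F : Finset ℤ, (∀ i ∈ F, y i = true) →
      ∃ a : ℤ, ∀ i ∈ F, ∃ m ∈ E, (m : ℤ) = a + i}) ?_ ?_
  · simp only [ofPred_forall]
    refine isClosed_iInter fun k => ?_
    have : {y : ℤ → Bool | ∃ j < r, y (k + j) = true} =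
        ⋃ j ∈ Iio r, {y : ℤ → Bool | y (k + j) = true} := by
      ext y
      simp
    rw [this]
    exact (finite_Iio r).isClosed_biUnion fun j _ => (hclopen _).1
  · simp only [ofPred_forall]
    refine isClosed_iInter fun F => isClosed_imp ?_ isClosed_const
    have : {y : ℤ → Bool | ∀ i ∈ F, y i = true} = ⋂ i ∈ F, {y : ℤ → Bool | y i = true} := by
      ext y
      simp
    rw [this]
    exact isOpen_biInter_finset fun i _ => (hclopen i).2

theorem mem_patternSpace_iff_binaryShift (E : Set ℕ) (r : ℕ) (y : ℤ → Bool) :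
    y ∈ patternSpace E r ↔ binaryShift y ∈ patternSpace E r := by
  simp only [patternSpace, mem_ofPred_eq, binaryShift_apply]
  constructor
  · rintro ⟨h₁, h₂⟩
    refine ⟨fun k => ?_, fun F hF => ?_⟩
    · obtain ⟨j, hj, hy⟩ := h₁ (k + 1)
      exact ⟨j, hj, by rwa [add_right_comm]⟩
    · obtain ⟨a, ha⟩ := h₂ (F.image (· + 1)) (by
        rw [Finset.forall_mem_image]
        exact fun i hi => hF i hi)
      refine ⟨a + 1, fun i hi => ?_⟩
      obtain ⟨m, hm, hma⟩ := ha (i + 1) (Finset.mem_image_of_mem _ hi)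
      exact ⟨m, hm, by omega⟩
  · rintro ⟨h₁, h₂⟩
    refine ⟨fun k => ?_, fun F hF => ?_⟩
    · obtain ⟨j, hj, hy⟩ := h₁ (k - 1)
      exact ⟨j, hj, by rwa [show k - 1 + j + 1 = k + (j : ℤ) by ring] at hy⟩
    · obtain ⟨a, ha⟩ := h₂ (F.image (· - 1)) (by
        simp only [Finset.forall_mem_image, sub_add_cancel]
        exact fun i hi => hF i hi)
      refine ⟨a - 1, fun i hi => ?_⟩
      obtain ⟨m, hm, hma⟩ := ha (i - 1) (Finset.mem_image_of_mem _ hi)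
      exact ⟨m, hm, by omega⟩

theorem patternSpace_nonempty {E : Set ℕ} {r : ℕ}
    (hE : ∀ a : ℕ, 1 ≤ a → ∃ m ∈ E, a ≤ m ∧ m < a + r) : (patternSpace E r).Nonempty := by
  classical
  let P (i : ℤ) (a : ℕ) : Prop := ∃ m ∈ E, (m : ℤ) = a + i
  refine ⟨fun i => decide (∀ᶠ a in (hyperfilter ℕ : Filter ℕ), P i a), fun k => ?_,
    fun F hF => ?_⟩
  · have hev : ∀ᶠ a in (hyperfilter ℕ : Filter ℕ), ∃ j ∈ Iio r, P (k + (j : ℕ)) a := by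
      refine Nat.hyperfilter_le_atTop ?_
      filter_upwards [eventually_ge_atTop (k.natAbs + 1)] with a ha
      obtain ⟨m, hm, h₁, h₂⟩ := hE (a + k).toNat (by omega)
      exact ⟨m - (a + k).toNat, by simp only [mem_Iio]; omega, m, hm, by omega⟩
    obtain ⟨j, hj, h⟩ := (Ultrafilter.eventually_exists_mem_iff (finite_Iio r)).1 hev
    exact ⟨j, hj, decide_eq_true h⟩
  · have hev : ∀ᶠ a in (hyperfilter ℕ : Filter ℕ), ∀ i ∈ F, P i a :=
      (eventually_all_finset F).2 fun i hi => of_decide_eq_true (hF i hi)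
    obtain ⟨a, ha⟩ := hev.exists
    exact ⟨a, ha⟩

theorem binaryShift_subtype_iterate_apply {M : Set (ℤ → Bool)}
    (hM : ∀ y, y ∈ M ↔ binaryShift y ∈ M) (n : ℕ) (y : M) (i : ℤ) :
    ((binaryShift.subtype hM)^[n] y).1 i = y.1 (i + n) := by
  induction n generalizing y with
  | zero => simp
  | succ n ih =>
    rw [Function.iterate_succ_apply, ih]
    change binaryShift y.1 (i + n) = _
    rw [binaryShift_apply]
    push_cast
    rw [add_assoc]

/-- `R` is a set of `ℓ`-recurrence iff every syndetic set of positive integers contains an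
arithmetic progression of length `ℓ+1` whose common difference belongs to `R`. -/
theorem rec_iff_syndetic (ℓ : ℕ) (hℓ : 1 ≤ ℓ) (R : Set ℕ) (hR : ∀ n ∈ R, 1 ≤ n) :
    IsRecSet ℓ R ↔
      ∀ E : Set ℕ, (∀ n ∈ E, 1 ≤ n) → SyndeticPos E →
        ∃ a n : ℕ, n ∈ R ∧ ∀ j ≤ ℓ, a + j * n ∈ E := by
  constructor
  · rintro hrec E hE ⟨r, -, hr⟩
    obtain ⟨M, hMY, hMc, ⟨y, hy⟩, hTM, hmin⟩ := exists_isMinimal_subtype binaryShift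
      (isClosed_patternSpace E r) (patternSpace_nonempty hr) (mem_patternSpace_iff_binaryShift E r)
    have : CompactSpace M := isCompact_iff_compactSpace.1 hMc.isCompact
    let _ : MetricSpace M := TopologicalSpace.metrizableSpaceMetric M
    obtain ⟨n, hnR, -, x, hx⟩ := hrec M (binaryShift.subtype hTM) hmin
      {z : M | z.1 0 = true}
      ((isOpen_discrete {true}).preimage
        (f := fun z : M => z.1 0) ((continuous_apply 0).comp continuous_subtype_val))
      (by
        obtain ⟨j, -, hj⟩ := (hMY hy).1 0
        refine ⟨(binaryShift.subtype hTM)^[j] ⟨y, hy⟩, ?_⟩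
        rwa [mem_ofPred_eq, binaryShift_subtype_iterate_apply])
    simp only [mem_ofPred_eq, binaryShift_subtype_iterate_apply, zero_add] at hx
    obtain ⟨a, ha⟩ := (hMY x.2).2 ((Finset.range (ℓ + 1)).image fun j => ((j * n : ℕ) : ℤ)) (by
      simp only [Finset.forall_mem_image, Finset.mem_range, Nat.lt_succ_iff]
      exact fun j hj => hx j hj)
    simp only [Finset.forall_mem_image, Finset.mem_range, Nat.lt_succ_iff] at ha
    obtain ⟨b, -, hb⟩ := ha (Nat.zero_le ℓ)
    refine ⟨b, n, hnR, fun j hj => ?_⟩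
    obtain ⟨m, hm, hma⟩ := ha hj
    have : m = b + j * n := by
      simp only [zero_mul, Nat.cast_zero, add_zero] at hb
      rw [← hb] at hma
      exact_mod_cast hma
    exact this ▸ hm
  · intro h X _ _ T hT U hU hne
    obtain ⟨N, hN⟩ := hT.exists_forall_exists_iterate_mem hU hne
    obtain ⟨x, -⟩ := hne
    obtain ⟨a, n, hn, hap⟩ := h {m | 1 ≤ m ∧ T^[m] x ∈ U} (fun m hm => hm.1)
      ⟨N + 1, by omega, fun a ha => by
        obtain ⟨k, hk, hkU⟩ := hN (T^[a] x)
        rw [← Function.iterate_add_apply] at hkU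
        exact ⟨k + a, ⟨by omega, hkU⟩, by omega, by omega⟩⟩
    refine ⟨n, hn, hR n hn, T^[a] x, fun j hj => ?_⟩
    rw [← Function.iterate_add_apply, add_comm]
    exact (hap j hj).2
end

section
/- Let π : (X,T) → (Y,S) be a factor map between topological dynamical systems such that (Y,S) is minimal. If there exists y₀ ∈ Y whose fiber π^{-1}({y₀}) is proximal, then every fiber π^{-1}({y}), y ∈ Y, is proximal; that is, π is a proximal extension. -/
/-- Two points `x₁, x₂` are proximal: `inf_{n ≥ 1} d(Tⁿx₁, Tⁿx₂) = 0`. -/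
def Proximal {X : Type} [MetricSpace X] (T : X → X) (x₁ x₂ : X) : Prop :=
  ∀ ε : ℝ, 0 < ε → ∃ n : ℕ, 1 ≤ n ∧ dist (T^[n] x₁) (T^[n] x₂) < ε

open Filter Topology

/-- The set of cluster points of a forward orbit of a homeomorphism is invariant. -/
lemma image_setOf_mapClusterPt_iterate {Z : Type*} [TopologicalSpace Z] (F : Z ≃ₜ Z) (z : Z) :
    F '' {p | MapClusterPt p atTop fun n : ℕ => F^[n] z} =
      {p | MapClusterPt p atTop fun n : ℕ => F^[n] z} := by
  ext p
  constructor
  · rintro ⟨q, hq, rfl⟩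
    have hF : MapClusterPt (F q) atTop ((fun n : ℕ => F^[n] z) ∘ fun n => n + 1) := by
      convert MapClusterPt.continuousAt_comp F.continuous.continuousAt hq using 1
      funext n
      exact Function.iterate_succ_apply' F n z
    exact hF.of_comp (tendsto_add_atTop_nat 1)
  · intro hp
    refine ⟨F.symm p, ?_, F.apply_symm_apply p⟩
    have hF : MapClusterPt (F.symm p) atTop (F.symm ∘ fun n : ℕ => F^[n] z) :=
      MapClusterPt.continuousAt_comp F.symm.continuous.continuousAt hp
    have heq : (F.symm ∘ fun n : ℕ => F^[n] z) =ᶠ[atTop]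
        (fun n : ℕ => F^[n] z) ∘ fun n => n - 1 := by
      filter_upwards [eventually_ge_atTop 1] with n hn
      obtain ⟨m, rfl⟩ := Nat.exists_eq_add_of_le' hn
      simp [Function.iterate_succ_apply', -Function.iterate_succ]
    have hF' : MapClusterPt (F.symm p) atTop ((fun n : ℕ => F^[n] z) ∘ fun n => n - 1) := by
      rw [MapClusterPt, ← map_congr heq]
      exact hF
    exact hF'.of_comp (tendsto_sub_atTop_nat 1)

/-- If `π : (X,T) → (Y,S)` is a factor map with `(Y,S)` minimal and some fiber
`π⁻¹({y₀})` is proximal, then every fiber is proximal, i.e. `π` is a proximal extension. -/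
theorem proximal_fiber_implies_proximal_extension
    {X Y : Type} [MetricSpace X] [CompactSpace X] [MetricSpace Y] [CompactSpace Y]
    (T : X ≃ₜ X) (S : Y ≃ₜ Y) (π : X → Y)
    (hπcont : Continuous π) (hπsurj : Function.Surjective π)
    (hπfac : ∀ x : X, π (T x) = S (π x))
    (hYmin : IsMinimal (⇑S))
    (h : ∃ y₀ : Y, ∀ x₁ x₂ : X, π x₁ = y₀ → π x₂ = y₀ → Proximal (⇑T) x₁ x₂) :
    ∀ x₁ x₂ : X, π x₁ = π x₂ → Proximal (⇑T) x₁ x₂ := by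
  obtain ⟨y₀, hy₀⟩ := h
  intro x₁ x₂ hx ε hε
  let F : X × X ≃ₜ X × X := T.prodCongr T
  have hiter (n : ℕ) (p : X × X) : F^[n] p = (T^[n] p.1, T^[n] p.2) := by
    change (Prod.map T T)^[n] p = _
    rw [Prod.map_iterate, Prod.map_apply']
  have hπiter (n : ℕ) (x : X) : π (T^[n] x) = S^[n] (π x) :=
    (show Function.Semiconj π T S from hπfac).iterate_right n x
  let W : Set (X × X) := {p | MapClusterPt p atTop fun n : ℕ => F^[n] (x₁, x₂)}
  have hWclosed : IsClosed W := isClosed_setOfPred_clusterPt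
  have hWne : W.Nonempty := exists_clusterPt_of_compactSpace _
  have hWinv : F '' W = W := image_setOf_mapClusterPt_iterate F (x₁, x₂)
  have hWfiber : ∀ p ∈ W, π p.1 = π p.2 := by
    intro p hp
    have hclosed : IsClosed {q : X × X | π q.1 = π q.2} :=
      isClosed_eq (hπcont.comp continuous_fst) (hπcont.comp continuous_snd)
    refine hclosed.mem_of_mapClusterPt hp (Eventually.of_forall fun n => ?_)
    simp only [hiter, Set.mem_ofPred_eq, hπiter, hx]
  have himage : (fun p : X × X => π p.1) '' W = Set.univ := by
    refine hYmin _ (hWclosed.isCompact.image (hπcont.comp continuous_fst)).isClosed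
      (hWne.image _) ?_
    conv_rhs => rw [← hWinv]
    rw [Set.image_image, Set.image_image]
    exact Set.image_congr fun p _ => (hπfac p.1).symm
  obtain ⟨p, hpW, hp⟩ : y₀ ∈ (fun p : X × X => π p.1) '' W := himage ▸ Set.mem_univ y₀
  obtain ⟨n, -, hn⟩ := hy₀ p.1 p.2 hp ((hWfiber p hpW).symm.trans hp) ε hε
  have hmaps : Set.MapsTo F W W := Set.mapsTo_iff_image_subset.mpr hWinv.subset
  have hnW : MapClusterPt (F^[n] p) atTop fun n : ℕ => F^[n] (x₁, x₂) := hmaps.iterate n hpW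
  have hopen : {q : X × X | dist q.1 q.2 < ε} ∈ 𝓝 (F^[n] p) := by
    refine (isOpen_lt continuous_dist continuous_const).mem_nhds ?_
    simpa only [hiter, Set.mem_ofPred_eq] using hn
  obtain ⟨m, hm, hm1⟩ :=
    ((hnW.frequently hopen).and_eventually (eventually_ge_atTop 1)).exists
  exact ⟨m, hm1, by simpa only [hiter] using hm⟩
end

section
/- Let π : (X,T) → (Y,S) be a proximal extension between minimal systems. Then for every ℓ ≥ 1 and all points x₀, x₁, …, x_ℓ ∈ X lying in the same fiber of π, there exists a sequence of positive integers (n_i) such that for every k with 0 ≤ k ≤ ℓ the sequence (T^{n_i} x_k) converges to x₀. -/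
/-- In a compact Hausdorff space, every nonempty closed forward-invariant set contains a minimal
one, and the map sends this minimal set onto itself. -/
theorem exists_minimal_closed_mapsTo {Z : Type*} [TopologicalSpace Z] [CompactSpace Z] [T2Space Z]
    {F : Z → Z} (hF : Continuous F) {K : Set Z} (hK : IsClosed K) (hne : K.Nonempty)
    (hmaps : Set.MapsTo F K K) :
    ∃ M ⊆ K, IsClosed M ∧ M.Nonempty ∧ F '' M = M ∧
      ∀ N ⊆ M, IsClosed N → N.Nonempty → Set.MapsTo F N N → N = M := by
  obtain ⟨M, hMK, hM⟩ := zorn_superset_nonempty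
    {M : Set Z | IsClosed M ∧ M.Nonempty ∧ Set.MapsTo F M M} (fun c hc hchain hcne =>
      ⟨⋂₀ c, ⟨isClosed_sInter fun s hs => (hc hs).1,
        by
          have : Nonempty c := hcne.to_subtype
          exact IsCompact.nonempty_sInter_of_directed_nonempty_isCompact_isClosed
            (fun a ha b hb => (hchain.total ha hb).elim
              (fun h => ⟨a, ha, subset_rfl, h⟩) (fun h => ⟨b, hb, h, subset_rfl⟩)) (fun s hs => (hc hs).2.1)
            (fun s hs => (hc hs).1.isCompact) (fun s hs => (hc hs).1),
        fun z hz s hs => (hc hs).2.2 (hz s hs)⟩,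
        fun s hs => Set.sInter_subset_of_mem hs⟩) K ⟨hK, hne, hmaps⟩
  have hmin : ∀ N ⊆ M, IsClosed N → N.Nonempty → Set.MapsTo F N N → N = M :=
    fun N hN h₁ h₂ h₃ => hN.antisymm (hM.2 ⟨h₁, h₂, h₃⟩ hN)
  obtain ⟨hMc, hMne, hMm⟩ := hM.1
  exact ⟨M, hMK, hMc, hMne, hmin _ hMm.image_subset (hMc.isCompact.image hF).isClosed
    (hMne.image F) (fun z hz => ⟨z, hMm.image_subset hz, rfl⟩), hmin⟩

/-- Let `M` be a minimal closed forward-invariant set of tuples. If the entries `i` and `j` of each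
tuple in `M` are proximal, then they are equal. -/
theorem eq_of_proximal_of_minimal {X ι : Type} [MetricSpace X] [CompactSpace X]
    {T : X → X} {M : Set (ι → X)} (hMc : IsClosed M) (hMne : M.Nonempty)
    (hMm : Set.MapsTo (T ∘ ·) M M)
    (hmin : ∀ N ⊆ M, IsClosed N → N.Nonempty → Set.MapsTo (T ∘ ·) N N → N = M)
    {i j : ι} (hprox : ∀ w ∈ M, Proximal T (w i) (w j)) :
    ∀ w ∈ M, w i = w j := by
  have hN : M ∩ {w | w i = w j} = M := by
    refine hmin _ Set.inter_subset_left
      (hMc.inter (isClosed_eq (continuous_apply i) (continuous_apply j))) ?_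
      (fun w hw => ⟨hMm hw.1, congrArg T hw.2⟩)
    obtain ⟨w, hw, hwmin⟩ := hMc.isCompact.exists_isMinOn hMne
      (f := fun w : ι → X => dist (w i) (w j)) (by fun_prop)
    refine ⟨w, hw, ?_⟩
    by_contra hne
    obtain ⟨n, -, hn⟩ := hprox w hw _ (dist_pos.2 hne)
    have hiter : ∀ n : ℕ, T^[n] ∘ w ∈ M := by
      intro n
      induction n with
      | zero => exact hw
      | succ n ih =>
        rw [Function.iterate_succ', Function.comp_assoc]
        exact hMm ih
    exact absurd (hwmin (hiter n)) (not_le.2 hn)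
  exact fun w hw => (hN.symm ▸ hw : w ∈ M ∩ {w | w i = w j}).2

/-- If `π : (X,T) → (Y,S)` is a proximal extension between minimal systems, then for every
`ℓ ≥ 1` and all points `x₀, …, x_ℓ` in a common fiber of `π` there is a sequence of positive
integers `(n_i)` with `T^{n_i} x_k → x₀` for every `0 ≤ k ≤ ℓ`. -/
theorem proximal_extension_fiber_sync
    {X Y : Type} [MetricSpace X] [CompactSpace X] [MetricSpace Y] [CompactSpace Y]
    (T : X ≃ₜ X) (S : Y ≃ₜ Y) (π : X → Y)
    (hπcont : Continuous π) (hπsurj : Function.Surjective π)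
    (hπfac : ∀ x : X, π (T x) = S (π x))
    (hXmin : IsMinimal (⇑T)) (hYmin : IsMinimal (⇑S))
    (hprox : ∀ x₁ x₂ : X, π x₁ = π x₂ → Proximal (⇑T) x₁ x₂)
    (ℓ : ℕ) (hℓ : 1 ≤ ℓ) (x : ℕ → X) (hfiber : ∀ k ≤ ℓ, π (x k) = π (x 0)) :
    ∃ n : ℕ → ℕ, (∀ i, 1 ≤ n i) ∧
      ∀ k ≤ ℓ, Filter.Tendsto (fun i => (⇑T)^[n i] (x k)) Filter.atTop (nhds (x 0)) := by
  let z : Fin (ℓ + 1) → X := fun k => x k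
  let O : Set (Fin (ℓ + 1) → X) := {w | ∃ n : ℕ, 1 ≤ n ∧ T^[n] ∘ z = w}
  have hF : Continuous (fun w : Fin (ℓ + 1) → X => T ∘ w) :=
    continuous_pi fun k => T.continuous.comp (continuous_apply k)
  have hO : Set.MapsTo (T ∘ ·) O O := by
    rintro _ ⟨n, hn, rfl⟩
    refine ⟨n + 1, by omega, ?_⟩
    rw [Function.iterate_succ', Function.comp_assoc]
  obtain ⟨M, hMO, hMc, hMne, hMF, hmin⟩ := exists_minimal_closed_mapsTo hF
    (isClosed_closure (s := O)) ⟨_, subset_closure ⟨1, le_rfl, rfl⟩⟩ (hO.closure hF)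
  have hfib : ∀ k, ∀ w ∈ closure O, π (w k) = π (w 0) := by
    intro k
    refine closure_minimal (t := {w : Fin (ℓ + 1) → X | π (w k) = π (w 0)}) ?_
      (isClosed_eq (by fun_prop) (by fun_prop))
    rintro _ ⟨n, -, rfl⟩
    have hsemi : Function.Semiconj π T S := hπfac
    change π (T^[n] (x k)) = π (T^[n] (x (0 : Fin (ℓ + 1))))
    rw [(hsemi.iterate_right n).eq, (hsemi.iterate_right n).eq, hfiber k (by omega)]
    rfl
  have hdiag : ∀ k, ∀ w ∈ M, w k = w 0 := fun k =>
    eq_of_proximal_of_minimal hMc hMne (Set.mapsTo_iff_image_subset.2 hMF.subset) hmin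
      fun w hw => hprox _ _ (hfib k w (hMO hw))
  have hproj : (fun w : Fin (ℓ + 1) → X => w 0) '' M = Set.univ := by
    refine hXmin _ (hMc.isCompact.image (continuous_apply 0)).isClosed (hMne.image _) ?_
    conv_rhs => rw [← hMF]
    simp only [Set.image_image, Function.comp_apply]
  obtain ⟨w, hw, hw0⟩ : x 0 ∈ (fun w : Fin (ℓ + 1) → X => w 0) '' M := hproj ▸ Set.mem_univ _
  obtain ⟨u, huO, hu⟩ := mem_closure_iff_seq_limit.1 (hMO hw)
  choose n hn hnu using huO
  refine ⟨n, hn, fun k hk => ?_⟩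
  have hk' : k < ℓ + 1 := by omega
  have h := (tendsto_pi_nhds.1 hu) ⟨k, hk'⟩
  rw [hdiag _ w hw, show w 0 = x 0 from hw0] at h
  refine h.congr fun i => ?_
  rw [← hnu i]
  rfl
end

section
/- Let π : (X,T) → (Y,S) be a proximal extension between minimal systems, let ℓ ≥ 1, and let R be a set of positive integers that is a set of ℓ-recurrence for (Y,S), i.e. for every nonempty open V ⊆ Y there exists n ∈ R with V ∩ S^{-n}V ∩ ⋯ ∩ S^{-ℓn}V ≠ ∅. Then R is a set of ℓ-recurrence for (X,T): for every nonempty open U ⊆ X there exists n ∈ R with U ∩ T^{-n}U ∩ ⋯ ∩ T^{-ℓn}U ≠ ∅. -/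
open Set in
/-- In a minimal system on a compact space, every forward orbit meets every nonempty open set. -/
theorem IsMinimal.exists_iterate_mem {X : Type} [TopologicalSpace X] [CompactSpace X]
    {T : X ≃ₜ X} (hT : IsMinimal (⇑T)) {U : Set X} (hU : IsOpen U) (hne : U.Nonempty) (x : X) :
    ∃ n : ℕ, T^[n] x ∈ U := by
  by_contra! hx
  let C : Set X := {z | ∀ n : ℕ, T^[n] z ∈ Uᶜ}
  have hC : IsClosed C := by
    simp only [C, ofPred_forall]
    exact isClosed_iInter fun n => hU.isClosed_compl.preimage (T.continuous.iterate n)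
  have hTC : ∀ z ∈ C, T z ∈ C := fun z hz n => hz (n + 1)
  let D : ℕ → Set X := fun n => T.symm^[n] ⁻¹' C
  have hanti : ∀ n, D (n + 1) ⊆ D n := fun n z hz => by
    have h := hTC _ hz
    rwa [Function.iterate_succ_apply', T.apply_symm_apply] at h
  have hDcl : ∀ n, IsClosed (D n) := fun n => hC.preimage (T.symm.continuous.iterate n)
  have hDne : (⋂ n, D n).Nonempty :=
    IsCompact.nonempty_iInter_of_sequence_nonempty_isCompact_isClosed D hanti
      (fun n => ⟨T^[n] x, by
        change T.symm^[n] (T^[n] x) ∈ C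
        rw [Function.LeftInverse.iterate T.symm_apply_apply n x]
        exact hx⟩)
      (hDcl 0).isCompact hDcl
  have hinv : T '' (⋂ n, D n) = ⋂ n, D n := by
    ext z
    simp only [mem_image, mem_iInter]
    constructor
    · rintro ⟨w, hw, rfl⟩ n
      apply hanti n
      change T.symm^[n + 1] (T w) ∈ C
      rw [Function.iterate_succ_apply, T.symm_apply_apply]
      exact hw n
    · exact fun hz => ⟨T.symm z, fun n => hz (n + 1), T.apply_symm_apply z⟩
  obtain ⟨u, hu⟩ := hne
  have huD : u ∈ ⋂ n, D n := by
    rw [hT _ (isClosed_iInter hDcl) hDne hinv]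
    trivial
  exact mem_iInter.1 huD 0 0 hu

/-- A nonempty closed forward invariant set of tuples with pairwise proximal coordinates contains
a tuple all of whose coordinates in a given finite set agree. -/
theorem exists_mem_forall_eq_of_proximal {X ι : Type} [MetricSpace X] [CompactSpace X]
    {T : X → X} (i₀ : ι) (s : Finset ι)
    {A : Set (ι → X)} (hA : IsClosed A) (hne : A.Nonempty)
    (hinv : ∀ p ∈ A, (fun i => T (p i)) ∈ A)
    (hprox : ∀ p ∈ A, ∀ i j, Proximal T (p i) (p j)) :
    ∃ q ∈ A, ∀ i ∈ s, q i = q i₀ := by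
  classical
  induction s using Finset.induction_on with
  | empty => exact hne.imp fun q hq => ⟨hq, by simp⟩
  | insert a s _ ih =>
    let B : Set (ι → X) := A ∩ {q | ∀ i ∈ s, q i = q i₀}
    have hB : IsClosed B := by
      refine hA.inter ?_
      simp only [Set.ofPred_forall]
      exact isClosed_biInter fun i _ => isClosed_eq (continuous_apply i) (continuous_apply i₀)
    have hBinv : ∀ n : ℕ, ∀ p ∈ B, (fun i => T^[n] (p i)) ∈ B := by
      intro n
      induction n with
      | zero => exact fun p hp => hp
      | succ n ihn =>
        exact fun p hp => ihn _ ⟨hinv p hp.1, fun i hi => congrArg T (hp.2 i hi)⟩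
    obtain ⟨q, hq, hmin⟩ := hB.isCompact.exists_isMinOn ih
      (f := fun q : ι → X => dist (q a) (q i₀)) (by fun_prop)
    refine ⟨q, hq.1, fun i hi => ?_⟩
    rcases Finset.mem_insert.1 hi with rfl | hi
    · by_contra hne
      obtain ⟨n, -, hn⟩ := hprox q hq.1 i i₀ _ (dist_pos.2 hne)
      exact absurd hn (not_lt.2 (hmin (hBinv n q hq)))
    · exact hq.2 i hi

/-- If `π : (X,T) → (Y,S)` is a proximal extension between minimal systems and `R` is a set
of `ℓ`-recurrence for `(Y,S)`, then `R` is a set of `ℓ`-recurrence for `(X,T)`. -/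
theorem proximal_extension_lifts_recurrence
    {X Y : Type} [MetricSpace X] [CompactSpace X] [MetricSpace Y] [CompactSpace Y]
    (T : X ≃ₜ X) (S : Y ≃ₜ Y) (π : X → Y)
    (hπcont : Continuous π) (hπsurj : Function.Surjective π)
    (hπfac : ∀ x : X, π (T x) = S (π x))
    (hXmin : IsMinimal (⇑T)) (hYmin : IsMinimal (⇑S))
    (hprox : ∀ x₁ x₂ : X, π x₁ = π x₂ → Proximal (⇑T) x₁ x₂)
    (ℓ : ℕ) (hℓ : 1 ≤ ℓ) (R : Set ℕ)
    (hRY : ∀ V : Set Y, IsOpen V → V.Nonempty → ∃ n ∈ R, n ∈ RetTimes (⇑S) ℓ V) :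
    ∀ U : Set X, IsOpen U → U.Nonempty → ∃ n ∈ R, n ∈ RetTimes (⇑T) ℓ U := by
  intro U hU hUne
  let B : Set (Fin (ℓ + 1) → X) := {p | ∀ m : ℕ, ¬ ∀ j, T^[m] (p j) ∈ U}
  have hB : IsClosed B := by
    simp only [B, Set.ofPred_forall]
    refine isClosed_iInter fun m => isOpen_compl_iff.1 ?_
    have h : IsOpen (⋂ j : Fin (ℓ + 1), {p : Fin (ℓ + 1) → X | T^[m] (p j) ∈ U}) :=
      isOpen_iInter_of_finite fun j =>
        hU.preimage ((T.continuous.iterate m).comp (continuous_apply j))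
    convert h using 1
    ext p
    simp
  have hfiber : ∀ p ∈ B, ¬ ∀ j, π (p j) = π (p 0) := by
    intro p hpB hp
    obtain ⟨q, hq, hconst⟩ := exists_mem_forall_eq_of_proximal (T := T) 0 Finset.univ
      (A := B ∩ {p | ∀ j, π (p j) = π (p 0)})
      (hB.inter (by
        simp only [Set.ofPred_forall]
        exact isClosed_iInter fun j => isClosed_eq (by fun_prop) (by fun_prop)))
      ⟨p, hpB, hp⟩
      (fun p hp => ⟨fun m => hp.1 (m + 1), fun j => by
        simp only [hπfac]
        rw [hp.2 j]⟩)
      (fun p hp i j => hprox _ _ ((hp.2 i).trans (hp.2 j).symm))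
    obtain ⟨m, hm⟩ := hXmin.exists_iterate_mem hU hUne (q 0)
    exact hq.1 m fun j => by rwa [hconst j (Finset.mem_univ j)]
  obtain ⟨δ, hδ, hBδ⟩ : ∃ δ : ℝ, 0 < δ ∧
      ∀ p ∈ B, δ ≤ dist (fun j => π (p j)) (fun _ => π (p 0)) := by
    rcases B.eq_empty_or_nonempty with hE | hne
    · exact ⟨1, one_pos, by simp [hE]⟩
    · obtain ⟨p, hp, hmin⟩ := hB.isCompact.exists_isMinOn hne
        (f := fun p : Fin (ℓ + 1) → X => dist (fun j => π (p j)) (fun _ => π (p 0)))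
        (by fun_prop)
      exact ⟨_, dist_pos.2 fun h => hfiber p hp fun j => congrFun h j, fun q hq => hmin hq⟩
  obtain ⟨u, -⟩ := hUne
  obtain ⟨n, hnR, hn, y, hy⟩ := hRY (Metric.ball (π u) (δ / 2)) Metric.isOpen_ball
    ⟨_, Metric.mem_ball_self (half_pos hδ)⟩
  obtain ⟨x, rfl⟩ := hπsurj y
  have hiter : ∀ k : ℕ, π (T^[k] x) = S^[k] (π x) := fun k =>
    Function.Semiconj.iterate_right (f := π) hπfac k x
  have hclose : (fun j : Fin (ℓ + 1) => T^[j * n] x) ∉ B := by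
    refine fun h => not_lt.2 (hBδ _ h) ((dist_pi_lt_iff hδ).2 fun j => ?_)
    have hj := Metric.mem_ball.1 (hy j (Nat.lt_succ_iff.1 j.2))
    have h0 := Metric.mem_ball.1 (hy 0 (Nat.zero_le _))
    simp only [hiter, Fin.val_zero]
    linarith [dist_triangle_right (S^[j * n] (π x)) (S^[0 * n] (π x)) (π u)]
  obtain ⟨m, hm⟩ := not_forall_not.1 hclose
  refine ⟨n, hnR, hn, T^[m] x, fun j hj => ?_⟩
  have h := hm ⟨j, Nat.lt_succ_iff.2 hj⟩
  rwa [← Function.iterate_add_apply, add_comm, Function.iterate_add_apply] at h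
end

section
/- Let R be a set of positive integers such that for every minimal distal system (X,T) and every x ∈ X one has inf_{n ∈ R} d(T^n x, x) = 0 (i.e. R is a set of pointwise recurrence for distal systems). Then for every minimal distal system (X,T), every x ∈ X, and every ℓ ≥ 1, one has inf_{n ∈ R} max_{1 ≤ j ≤ ℓ} d(T^{jn} x, x) = 0; that is, R is a set of pointwise multiple recurrence for distal systems. -/
/-- A system `(X,T)` is distal if `inf_{n ≥ 1} d(Tⁿx, Tⁿy) > 0` for all `x ≠ y`. -/
def IsDistal {X : Type} [MetricSpace X] (T : X → X) : Prop :=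
  ∀ x y : X, x ≠ y → ∃ ε : ℝ, 0 < ε ∧ ∀ n : ℕ, 1 ≤ n → ε ≤ dist (T^[n] x) (T^[n] y)
open Set

/-- The closure of the forward orbit `{T x, T² x, …}`. -/
def forwardOrbitClosure {X : Type*} [TopologicalSpace X] (T : X → X) (x : X) : Set X :=
  closure (range fun n : ℕ => T^[n + 1] x)

/-- The Ellis enveloping semigroup: the pointwise closure of the iterates `T, T², …`. -/
def envelopingSemigroup {X : Type*} [TopologicalSpace X] (T : X → X) : Set (X → X) :=
  closure (range fun n : ℕ => T^[n + 1])

theorem comp_mem_envelopingSemigroup {X : Type*} [TopologicalSpace X] {T : X → X}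
    (hT : Continuous T) {p q : X → X} (hp : p ∈ envelopingSemigroup T)
    (hq : q ∈ envelopingSemigroup T) : p ∘ q ∈ envelopingSemigroup T := by
  have iterate_comp (n : ℕ) : T^[n + 1] ∘ q ∈ envelopingSemigroup T := by
    have hc : Continuous fun f : X → X => T^[n + 1] ∘ f :=
      continuous_pi fun x => (hT.iterate _).comp (continuous_apply x)
    refine closure_minimal (t := (fun f : X → X => T^[n + 1] ∘ f) ⁻¹' envelopingSemigroup T)
      ?_ (isClosed_closure.preimage hc) hq
    rintro _ ⟨m, rfl⟩
    refine subset_closure ⟨n + 1 + m, ?_⟩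
    dsimp only
    rw [← Function.iterate_add]
    rfl
  have hc : Continuous fun f : X → X => f ∘ q :=
    continuous_pi fun x => continuous_apply (q x)
  refine closure_minimal (t := (fun f : X → X => f ∘ q) ⁻¹' envelopingSemigroup T)
    ?_ (isClosed_closure.preimage hc) hp
  rintro _ ⟨n, rfl⟩
  exact iterate_comp n

theorem forwardOrbitClosure_eq_image {X : Type*} [TopologicalSpace X] [CompactSpace X]
    [T2Space X] (T : X → X) (x : X) :
    forwardOrbitClosure T x = (fun p : X → X => p x) '' envelopingSemigroup T := by
  rw [envelopingSemigroup, image_closure_of_isCompact isClosed_closure.isCompact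
    (continuous_apply x).continuousOn, ← range_comp]
  rfl

/-- In a distal system the only idempotent of the enveloping semigroup is the identity. -/
theorem IsDistal.eq_id_of_idempotent {X : Type} [MetricSpace X] {T : X → X} (hd : IsDistal T)
    {u : X → X} (hu : u ∈ envelopingSemigroup T) (huu : u ∘ u = u) : u = id := by
  funext x
  by_contra hne
  obtain ⟨ε, hε, h⟩ := hd (u x) x hne
  have hclosed : IsClosed {p : X → X | ε ≤ dist (p (u x)) (p x)} :=
    isClosed_le continuous_const ((continuous_apply (u x)).dist (continuous_apply x))
  have hle : ε ≤ dist (u (u x)) (u x) := by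
    refine closure_minimal ?_ hclosed hu
    rintro _ ⟨n, rfl⟩
    exact h (n + 1) n.succ_pos
  rw [show u (u x) = u x from congrFun huu x, dist_self] at hle
  exact hle.not_gt hε

/-- A nonempty closed subsemigroup of the enveloping semigroup of a distal system contains the
identity. -/
theorem IsDistal.id_mem {X : Type} [MetricSpace X] [CompactSpace X] {T : X → X}
    (hd : IsDistal T) {s : Set (X → X)} (hs : s ⊆ envelopingSemigroup T) (hne : s.Nonempty)
    (hclosed : IsClosed s) (hmul : ∀ p ∈ s, ∀ q ∈ s, p ∘ q ∈ s) : id ∈ s := by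
  let : Semigroup (X → X) := inferInstanceAs (Semigroup (Function.End X))
  obtain ⟨u, hu, huu⟩ := exists_idempotent_in_compact_subsemigroup (M := X → X)
    (fun q => continuous_pi fun x => continuous_apply (q x)) s hne hclosed.isCompact hmul
  exact hd.eq_id_of_idempotent (hs hu) huu ▸ hu

theorem IsDistal.self_mem_forwardOrbitClosure {X : Type} [MetricSpace X] [CompactSpace X]
    {T : X → X} (hT : Continuous T) (hd : IsDistal T) (x : X) :
    x ∈ forwardOrbitClosure T x := by
  rw [forwardOrbitClosure_eq_image]
  exact ⟨id, hd.id_mem subset_rfl (range_nonempty _).closure isClosed_closure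
    fun p hp q hq => comp_mem_envelopingSemigroup hT hp hq, rfl⟩

theorem IsDistal.mem_forwardOrbitClosure_symm {X : Type} [MetricSpace X] [CompactSpace X]
    {T : X → X} (hT : Continuous T) (hd : IsDistal T) {x y : X}
    (hy : y ∈ forwardOrbitClosure T x) : x ∈ forwardOrbitClosure T y := by
  rw [forwardOrbitClosure_eq_image] at hy ⊢
  obtain ⟨p, hp, rfl⟩ := hy
  have hc : Continuous fun q : X → X => q ∘ p :=
    continuous_pi fun z => continuous_apply (p z)
  obtain ⟨q, hq, hqp⟩ : id ∈ (fun q : X → X => q ∘ p) '' envelopingSemigroup T := by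
    refine hd.id_mem ?_ ((range_nonempty _).closure.image _)
      (isClosed_closure.isCompact.image hc).isClosed ?_
    · rintro _ ⟨q, hq, rfl⟩
      exact comp_mem_envelopingSemigroup hT hq hp
    · rintro _ ⟨q, hq, rfl⟩ _ ⟨r, hr, rfl⟩
      exact ⟨q ∘ p ∘ r, comp_mem_envelopingSemigroup hT hq (comp_mem_envelopingSemigroup hT hp hr),
        rfl⟩
  exact ⟨q, hq, congrFun hqp x⟩

theorem forwardOrbitClosure_subset {X : Type*} [TopologicalSpace X] {T : X → X} {K : Set X}
    (hK : IsClosed K) (hmaps : MapsTo T K K) {x : X} (hx : T x ∈ K) :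
    forwardOrbitClosure T x ⊆ K := by
  refine closure_minimal ?_ hK
  rintro _ ⟨n, rfl⟩
  exact hmaps.iterate n hx

theorem mapsTo_forwardOrbitClosure {X : Type*} [TopologicalSpace X] {T : X → X}
    (hT : Continuous T) (x : X) :
    MapsTo T (forwardOrbitClosure T x) (forwardOrbitClosure T x) := by
  refine MapsTo.closure ?_ hT
  rintro _ ⟨n, rfl⟩
  exact ⟨n + 1, Function.iterate_succ_apply' T (n + 1) x⟩

theorem IsDistal.image_forwardOrbitClosure {X : Type} [MetricSpace X] [CompactSpace X]
    {T : X → X} (hT : Continuous T) (hd : IsDistal T) (x : X) :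
    T '' forwardOrbitClosure T x = forwardOrbitClosure T x := by
  have hmaps := mapsTo_forwardOrbitClosure hT x
  refine hmaps.image_subset.antisymm (forwardOrbitClosure_subset ?_ ?_ ?_)
  · exact (isClosed_closure.isCompact.image hT).isClosed
  · exact (mapsTo_image T _).mono_left hmaps.image_subset
  · exact mem_image_of_mem T (hd.self_mem_forwardOrbitClosure hT x)

/-- A set of pointwise recurrence for minimal distal systems is a set of pointwise recurrence for
all distal systems, since orbit closures in distal systems are minimal. -/
theorem exists_recurrence_of_isDistal {R : Set ℕ}
    (hR : ∀ (X : Type) [MetricSpace X] [CompactSpace X] (T : X ≃ₜ X),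
      IsMinimal (⇑T) → IsDistal (⇑T) → ∀ x : X, ∀ ε : ℝ, 0 < ε →
        ∃ n ∈ R, dist ((⇑T)^[n] x) x < ε)
    {X : Type} [MetricSpace X] [CompactSpace X] (T : X ≃ₜ X) (hd : IsDistal T) (x : X)
    {ε : ℝ} (hε : 0 < ε) : ∃ n ∈ R, dist (T^[n] x) x < ε := by
  set Y := forwardOrbitClosure T x
  have hYclosed : IsClosed Y := isClosed_closure
  have : CompactSpace Y := isCompact_iff_compactSpace.mp hYclosed.isCompact
  have hxY : x ∈ Y := hd.self_mem_forwardOrbitClosure T.continuous x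
  have himage : T '' Y = Y := hd.image_forwardOrbitClosure T.continuous x
  let S : Y ≃ₜ Y := T.sets (by simpa [T.injective.preimage_image] using congrArg (preimage T) himage)
  have hS (n : ℕ) (y : Y) : ((S^[n] y : Y) : X) = T^[n] y :=
    (Function.Semiconj.iterate_right (f := ((↑) : Y → X)) (ga := S) (gb := T)
      (fun _ => rfl) n) y
  have hSmin : IsMinimal S := by
    rintro K hK ⟨y, hy⟩ hSK
    have hKclosed : IsClosed (((↑) : Y → X) '' K) := hYclosed.isClosedMap_subtype_val K hK
    have hmaps : MapsTo T (((↑) : Y → X) '' K) (((↑) : Y → X) '' K) := by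
      rintro _ ⟨z, hz, rfl⟩
      exact ⟨S z, hSK ▸ mem_image_of_mem S hz, rfl⟩
    have hxK : x ∈ ((↑) : Y → X) '' K :=
      forwardOrbitClosure_subset hKclosed hmaps (hmaps (mem_image_of_mem _ hy))
        (hd.mem_forwardOrbitClosure_symm T.continuous y.2)
    refine eq_univ_of_forall fun z => ?_
    obtain ⟨w, hw, hwz⟩ := forwardOrbitClosure_subset hKclosed hmaps (hmaps hxK) z.2
    rwa [← Subtype.ext hwz]
  have hSdistal : IsDistal S := by
    intro y z hyz
    obtain ⟨δ, hδ, h⟩ := hd y z (Subtype.coe_injective.ne hyz)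
    refine ⟨δ, hδ, fun n hn => ?_⟩
    rw [Subtype.dist_eq, hS, hS]
    exact h n hn
  obtain ⟨n, hn, h⟩ := hR Y S hSmin hSdistal ⟨x, hxY⟩ ε hε
  rw [Subtype.dist_eq, hS] at h
  exact ⟨n, hn, h⟩

/-- The homeomorphism `T × T² × ⋯ × T^ℓ` of `X^ℓ`. -/
def powerProduct {X : Type*} [TopologicalSpace X] (T : X ≃ₜ X) (ℓ : ℕ) :
    (Fin ℓ → X) ≃ₜ (Fin ℓ → X) :=
  Homeomorph.piCongrRight fun i => T ^ (i + 1 : ℕ)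

theorem powerProduct_iterate_apply {X : Type*} [TopologicalSpace X] (T : X ≃ₜ X) (ℓ n : ℕ)
    (x : Fin ℓ → X) (i : Fin ℓ) :
    (powerProduct T ℓ)^[n] x i = T^[(i + 1) * n] (x i) := by
  have hpow (m : ℕ) : ⇑(T ^ m) = T^[m] := by
    induction m with
    | zero => rfl
    | succ m ih => rw [pow_succ, Function.iterate_succ, ← ih]; rfl
  rw [Function.iterate_mul, ← hpow]
  exact (Function.Semiconj.iterate_right (f := fun y : Fin ℓ → X => y i)
    (ga := powerProduct T ℓ) (gb := ⇑(T ^ (i + 1 : ℕ))) (fun _ => rfl) n) x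

theorem IsDistal.powerProduct {X : Type} [MetricSpace X] {T : X ≃ₜ X} (hd : IsDistal T)
    (ℓ : ℕ) : IsDistal (powerProduct T ℓ) := by
  intro x y hxy
  obtain ⟨i, hi⟩ := Function.ne_iff.mp hxy
  obtain ⟨ε, hε, h⟩ := hd _ _ hi
  refine ⟨ε, hε, fun n hn => le_trans ?_ (dist_le_pi_dist _ _ i)⟩
  rw [powerProduct_iterate_apply, powerProduct_iterate_apply]
  exact h _ (Nat.mul_pos i.val.succ_pos hn)

/-- If `R` is a set of pointwise recurrence for minimal distal systems, then `R` is a set of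
pointwise multiple recurrence for minimal distal systems: for every minimal distal `(X,T)`,
every `x ∈ X` and every `ℓ ≥ 1`, `inf_{n ∈ R} max_{1 ≤ j ≤ ℓ} d(T^{jn}x, x) = 0`. -/
theorem pointwise_recurrence_distal_implies_multiple (R : Set ℕ)
    (hR : ∀ (X : Type) [MetricSpace X] [CompactSpace X] (T : X ≃ₜ X),
      IsMinimal (⇑T) → IsDistal (⇑T) → ∀ x : X, ∀ ε : ℝ, 0 < ε →
        ∃ n ∈ R, dist ((⇑T)^[n] x) x < ε) :
    ∀ (X : Type) [MetricSpace X] [CompactSpace X] (T : X ≃ₜ X),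
      IsMinimal (⇑T) → IsDistal (⇑T) → ∀ x : X, ∀ ℓ : ℕ, 1 ≤ ℓ → ∀ ε : ℝ, 0 < ε →
        ∃ n ∈ R, ∀ j : ℕ, 1 ≤ j → j ≤ ℓ → dist ((⇑T)^[j * n] x) x < ε := by
  intro X _ _ T _ hd x ℓ _ ε hε
  obtain ⟨n, hn, h⟩ := exists_recurrence_of_isDistal hR (powerProduct T ℓ) (hd.powerProduct ℓ)
    (fun _ => x) hε
  refine ⟨n, hn, fun j hj hjℓ => ?_⟩
  have hle := dist_le_pi_dist ((powerProduct T ℓ)^[n] fun _ => x) (fun _ => x)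
    ⟨j - 1, by lia⟩
  rw [powerProduct_iterate_apply, Nat.sub_add_cancel hj] at hle
  exact hle.trans_lt h
end

section
/- Let (X,T) be a minimal system and (Z,S) be a distal system. Then every closed orbit of the product transformation T × S on X × Z is minimal; that is, for every (x,z) ∈ X × Z, the closure W of the (T × S)-orbit of (x,z) is a minimal system for the restriction of T × S to W. -/
open Filter Topology

attribute [local instance] Ultrafilter.add Ultrafilter.addSemigroup

/-- Limits of orbits along ultrafilters on `ℕ` compose under addition of ultrafilters. -/
theorem tendsto_iterate_ultrafilter_add {Y : Type*} [TopologicalSpace Y] {f : Y → Y}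
    (hf : Continuous f) {U V : Ultrafilter ℕ} {y a b : Y}
    (hV : Tendsto (fun n => f^[n] y) V (𝓝 a)) (hU : Tendsto (fun n => f^[n] a) U (𝓝 b)) :
    Tendsto (fun n => f^[n] y) (U + V : Ultrafilter ℕ) (𝓝 b) := by
  rw [(nhds_basis_opens b).tendsto_right_iff]
  rintro s ⟨hbs, hs⟩
  rw [Ultrafilter.eventually_add]
  filter_upwards [hU (hs.mem_nhds hbs)] with m hm
  filter_upwards [((hf.iterate m).tendsto a).comp hV (hs.mem_nhds hm)] with n hn
  rw [Function.iterate_add_apply]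
  exact hn

/-- If a nonempty closed set `F` of limit points of the orbit of `y` is stable under the limits
along the ultrafilters sending `y` into `F`, then one such ultrafilter sends `y` to a point
of `F` that it fixes. -/
theorem exists_ultrafilter_tendsto_iterate_fixed {Y : Type*} [TopologicalSpace Y] [CompactSpace Y]
    [T2Space Y] {f : Y → Y} (hf : Continuous f) {y : Y} {F : Set Y} (hF : IsClosed F)
    (hne : F.Nonempty) (hcl : F ⊆ closure (Set.range fun n => f^[n] y))
    (hstable : ∀ (U : Ultrafilter ℕ), ∀ a ∈ F, ∀ a' ∈ F, ∀ b,
      Tendsto (fun n => f^[n] y) U (𝓝 a) → Tendsto (fun n => f^[n] a') U (𝓝 b) → b ∈ F) :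
    ∃ U : Ultrafilter ℕ, ∃ a ∈ F,
      Tendsto (fun n => f^[n] y) U (𝓝 a) ∧ Tendsto (fun n => f^[n] a) U (𝓝 a) := by
  have hlim : ∀ (U : Ultrafilter ℕ) (w : Y),
      Tendsto (fun n => f^[n] w) U (𝓝 (Ultrafilter.extend (fun n => f^[n] w) U)) :=
    fun U w => ultrafilter_extend_eq_iff.1 rfl
  obtain ⟨U, hUF, hU⟩ := exists_idempotent_in_compact_add_subsemigroup
    (M := Ultrafilter ℕ) Ultrafilter.continuous_add_left
    (Ultrafilter.extend (fun n => f^[n] y) ⁻¹' F) (by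
      obtain ⟨a, ha⟩ := hne
      have : (comap (fun n => f^[n] y) (𝓝 a)).NeBot := by
        rw [comap_neBot_iff]
        intro t ht
        obtain ⟨_, h, n, rfl⟩ := mem_closure_iff_nhds.1 (hcl ha) t ht
        exact ⟨n, h⟩
      refine ⟨Ultrafilter.of (comap (fun n => f^[n] y) (𝓝 a)), ?_⟩
      have h : Tendsto (fun n => f^[n] y) (Ultrafilter.of (comap (fun n => f^[n] y) (𝓝 a)))
          (𝓝 a) := tendsto_comap.mono_left (Ultrafilter.of_le _)
      rw [Set.mem_preimage, ultrafilter_extend_eq_iff.2 h]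
      exact ha)
    (hF.preimage (continuous_ultrafilter_extend _)).isCompact
    (fun U hU V hV => by
      have h := hstable U _ hU _ hV _ (hlim U y) (hlim U _)
      rw [Set.mem_preimage, ultrafilter_extend_eq_iff.2
        (tendsto_iterate_ultrafilter_add hf (hlim V y) (hlim U _))]
      exact h)
  refine ⟨U, _, hUF, hlim U y, ?_⟩
  have h := tendsto_iterate_ultrafilter_add hf (hlim U y) (hlim U _)
  rw [hU] at h
  have hfix := hlim U (Ultrafilter.extend (fun n => f^[n] y) U)
  rwa [← tendsto_nhds_unique (hlim U y) h] at hfix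

/-- In a distal system, points whose orbits have a common limit along a filter coincide. -/
theorem IsDistal.eq_of_tendsto {Z : Type} [MetricSpace Z] {S : Z → Z} (hS : IsDistal S)
    {l : Filter ℕ} [l.NeBot] {z w c : Z} (hz : Tendsto (fun n => S^[n] z) l (𝓝 c))
    (hw : Tendsto (fun n => S^[n] w) l (𝓝 c)) : z = w := by
  by_contra hne
  obtain ⟨ε, hε, h⟩ := hS z w hne
  have hd := hz.dist hw
  rw [dist_self] at hd
  obtain ⟨n, hn⟩ := (hd.eventually_lt_const (lt_min hε (dist_pos.2 hne))).exists
  rcases Nat.eq_zero_or_pos n with rfl | hpos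
  · exact (hn.trans_le (min_le_right _ _)).false
  · exact ((hn.trans_le (min_le_left _ _)).trans_le (h n hpos)).false

/-- Let `(X,T)` be a minimal system and `(Z,S)` a distal system. Then the closure `W` of the
`(T × S)`-orbit of any point `(x,z)` is a minimal set for `T × S`: any nonempty closed
`(T × S)`-invariant subset of `W` equals `W`. -/
theorem orbit_closure_minimal_of_distal
    {X Z : Type} [MetricSpace X] [CompactSpace X] [MetricSpace Z] [CompactSpace Z]
    (T : X ≃ₜ X) (S : Z ≃ₜ Z) (hXmin : IsMinimal (⇑T)) (hZdistal : IsDistal (⇑S))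
    (x : X) (z : Z) :
    ∀ K : Set (X × Z),
      K ⊆ closure {p : X × Z | ∃ n : ℕ, p = ((⇑T)^[n] x, (⇑S)^[n] z)} →
      IsClosed K → K.Nonempty →
      (fun p : X × Z => (T p.1, S p.2)) '' K = K →
      K = closure {p : X × Z | ∃ n : ℕ, p = ((⇑T)^[n] x, (⇑S)^[n] z)} := by
  intro K hKW hK hKne hKinv
  set R : X × Z → X × Z := fun p => (T p.1, S p.2) with hR
  have hRc : Continuous R := by fun_prop
  have hRn : ∀ (n : ℕ) (p : X × Z), R^[n] p = (T^[n] p.1, S^[n] p.2) := fun n p =>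
    congrFun (Prod.map_iterate T S n) p
  have hW : {p : X × Z | ∃ n : ℕ, p = (T^[n] x, S^[n] z)} = Set.range fun n => R^[n] (x, z) := by
    ext p
    simp [hRn, eq_comm]
  rw [hW] at hKW ⊢
  have hKmaps : ∀ n, Set.MapsTo R^[n] K K := fun n =>
    Set.MapsTo.iterate (fun p hp => hKinv ▸ Set.mem_image_of_mem R hp) n
  have hproj : Prod.fst '' K = Set.univ := by
    refine hXmin _ (hK.isCompact.image continuous_fst).isClosed (hKne.image _) ?_
    conv_rhs => rw [← hKinv]
    simp only [Set.image_image, hR]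
  obtain ⟨p, hpK, hpx⟩ : x ∈ Prod.fst '' K := hproj ▸ Set.mem_univ x
  have hfst : ∀ {U : Ultrafilter ℕ} {q b : X × Z}, Tendsto (fun n => R^[n] q) U (𝓝 b) →
      Tendsto (fun n => T^[n] q.1) U (𝓝 b.1) := fun {U q b} h => by
    simpa only [Function.comp_def, hRn] using (continuous_fst.tendsto b).comp h
  have hsnd : ∀ {U : Ultrafilter ℕ} {q b : X × Z}, Tendsto (fun n => R^[n] q) U (𝓝 b) →
      Tendsto (fun n => S^[n] q.2) U (𝓝 b.2) := fun {U q b} h => by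
    simpa only [Function.comp_def, hRn] using (continuous_snd.tendsto b).comp h
  obtain ⟨U, a, ⟨haK, hax⟩, hya, haa⟩ := exists_ultrafilter_tendsto_iterate_fixed hRc
    (y := (x, z)) (F := K ∩ Prod.fst ⁻¹' {x})
    (hK.inter (isClosed_singleton.preimage continuous_fst)) ⟨p, hpK, hpx⟩
    (Set.inter_subset_left.trans hKW) (by
      rintro U a ⟨-, hax⟩ a' ⟨haK', hax'⟩ b hya hab
      refine ⟨hK.mem_of_tendsto hab (Eventually.of_forall fun n => hKmaps n haK'), ?_⟩
      have h := hfst hab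
      rw [show a'.1 = x from hax'] at h
      exact (tendsto_nhds_unique h (hfst hya)).trans hax)
  have hyK : (x, z) ∈ K := by
    rwa [show (x, z) = a from
      Prod.ext (Eq.symm hax) (hZdistal.eq_of_tendsto (hsnd hya) (hsnd haa))]
  exact hKW.antisymm (closure_minimal (Set.range_subset_iff.2 fun n => hKmaps n hyK) hK)
end

section
/- Let ℓ ≥ 1. The family of sets of ℓ-recurrence has the Ramsey property: if R is a set of ℓ-recurrence and R = A ∪ B is a partition of R into two sets, then at least one of A or B is a set of ℓ-recurrence. -/
theorem exists_zpow_mem_of_isMinimal {X : Type} [TopologicalSpace X] {T : X ≃ₜ X}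
    (hT : IsMinimal (⇑T)) {U : Set X} (hU : IsOpen U) (hne : U.Nonempty) (x : X) :
    ∃ a : ℤ, (T ^ a) x ∈ U := by
  by_contra! hx
  let K : Set X := {y | ∀ a : ℤ, (T ^ a) y ∉ U}
  have hK : IsClosed K := by
    have : K = ⋂ a : ℤ, (T ^ a) ⁻¹' Uᶜ := by ext; simp [K]
    rw [this]
    exact isClosed_iInter fun a => hU.isClosed_compl.preimage (T ^ a).continuous
  have hzpow (a : ℤ) (y : X) : (T ^ a) (T y) = (T ^ (a + 1)) y := by
    rw [zpow_add_one]; rfl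
  have hinv : T ⁻¹' K = K := by
    ext y
    refine ⟨fun h a => ?_, fun h a => ?_⟩
    · simpa [hzpow] using h (a - 1)
    · simpa [hzpow] using h (a + 1)
  have himage : T '' K = K := by
    conv_lhs => rw [← hinv]
    exact Set.image_preimage_eq K T.surjective
  obtain ⟨u, hu⟩ := hne
  have huK : u ∈ K := hT K hK ⟨x, hx⟩ himage ▸ Set.mem_univ u
  exact huK 0 (by simpa using hu)

theorem zpow_iterate_apply_comm {X : Type} [TopologicalSpace X] (T : X ≃ₜ X) (a : ℤ) (m : ℕ)
    (x : X) : (T ^ a) (T^[m] x) = T^[m] ((T ^ a) x) := by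
  have h : Function.Commute (⇑(T ^ a)) (⇑T) := fun y =>
    congrArg (fun S : X ≃ₜ X => S y) ((Commute.refl T).zpow_left a).eq
  exact h.iterate_right m x

/-- Every homeomorphism of a nonempty compact space has a minimal nonempty closed invariant set. -/
theorem exists_minimal_closed_invariant_s9 {X : Type} [TopologicalSpace X] [CompactSpace X]
    [Nonempty X] (T : X ≃ₜ X) :
    ∃ M : Set X, Minimal (fun K => IsClosed K ∧ K.Nonempty ∧ T '' K = K) M := by
  obtain ⟨M, -, hM⟩ := zorn_superset_nonempty
    {K : Set X | IsClosed K ∧ K.Nonempty ∧ T '' K = K} (fun c hc hchain hcne => by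
      refine ⟨⋂₀ c, ⟨isClosed_sInter fun K hK => (hc hK).1, ?_, ?_⟩,
        fun K hK => Set.sInter_subset_of_mem hK⟩
      · have : Nonempty c := hcne.to_subtype
        exact IsCompact.nonempty_sInter_of_directed_nonempty_isCompact_isClosed
          (fun K hK L hL => (hchain.total hK hL).elim
            (fun h => ⟨K, hK, Set.Subset.rfl, h⟩) (fun h => ⟨L, hL, h, Set.Subset.rfl⟩))
          (fun K hK => (hc hK).2.1)
          (fun K hK => (hc hK).1.isCompact) (fun K hK => (hc hK).1)
      · rw [Set.sInter_eq_biInter, Set.image_iInter₂ T.bijective]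
        exact Set.iInter₂_congr fun K hK => (hc hK).2.2)
    Set.univ ⟨isClosed_univ, Set.univ_nonempty, by simp [T.surjective.range_eq]⟩
  exact ⟨M, hM⟩

/-- For a set of `ℓ`-recurrence, return times can be found inside any minimal subsystem. -/
theorem IsRecSet.exists_mem_of_minimal {ℓ : ℕ} {R : Set ℕ} (hR : IsRecSet ℓ R) {X : Type}
    [MetricSpace X] [CompactSpace X] (T : X ≃ₜ X) {M : Set X}
    (hM : Minimal (fun K => IsClosed K ∧ K.Nonempty ∧ T '' K = K) M) {W : Set X}
    (hW : IsOpen W) (hne : (M ∩ W).Nonempty) : ∃ n ∈ R, n ∈ RetTimes T ℓ W := by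
  obtain ⟨hclosed, -, hinv⟩ := hM.prop
  have : CompactSpace M := isCompact_iff_compactSpace.mp hclosed.isCompact
  let S : M ≃ₜ M := T.subtype fun x => by
    conv_rhs => rw [← hinv]
    exact (T.injective.mem_set_image).symm
  have hS : Function.Semiconj ((↑) : M → X) S T := fun _ => rfl
  have hSmin : IsMinimal (⇑S) := by
    intro K hK hKne hKinv
    have hle := hM.le_of_le (y := Subtype.val '' K)
      ⟨hclosed.isClosedEmbedding_subtypeVal.isClosedMap K hK, hKne.image _, by
        rw [Set.image_image]
        conv_rhs => rw [← hKinv, Set.image_image]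
        rfl⟩ (Subtype.coe_image_subset M K)
    refine Set.eq_univ_of_forall fun x => ?_
    obtain ⟨y, hy, hyx⟩ := hle x.2
    rwa [← Subtype.ext hyx]
  obtain ⟨x, hxM, hxW⟩ := hne
  obtain ⟨n, hn, hn1, y, hy⟩ := hR M S hSmin (Subtype.val ⁻¹' W)
    (hW.preimage continuous_subtype_val) ⟨⟨x, hxM⟩, hxW⟩
  refine ⟨n, hn, hn1, y, fun j hj => ?_⟩
  rw [← (hS.iterate_right (j * n)) y]
  exact hy j hj

/-- The family of sets of `ℓ`-recurrence has the Ramsey property: if a set of `ℓ`-recurrence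
`R` is partitioned as `R = A ∪ B`, then `A` or `B` is a set of `ℓ`-recurrence. -/
theorem recSet_ramsey (ℓ : ℕ) (hℓ : 1 ≤ ℓ) (R A B : Set ℕ) (hR : ∀ n ∈ R, 1 ≤ n)
    (hRec : IsRecSet ℓ R) (hunion : R = A ∪ B) (hdisj : Disjoint A B) :
    IsRecSet ℓ A ∨ IsRecSet ℓ B := by
  by_contra! h
  obtain ⟨hA, hB⟩ := h
  simp only [IsRecSet, not_forall] at hA hB
  obtain ⟨X, _, _, T, hT, U, hU, hUne, hA⟩ := hA
  obtain ⟨Y, _, _, S, hS, V, hV, hVne, hB⟩ := hB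
  have : Nonempty X := hUne.to_type
  have : Nonempty Y := hVne.to_type
  obtain ⟨M, hM⟩ := exists_minimal_closed_invariant_s9 (T.prodCongr S)
  obtain ⟨⟨x, y⟩, hxy⟩ := hM.prop.2.1
  obtain ⟨a, ha⟩ := exists_zpow_mem_of_isMinimal hT hU hUne x
  obtain ⟨b, hb⟩ := exists_zpow_mem_of_isMinimal hS hV hVne y
  obtain ⟨n, hn, hn1, ⟨p, q⟩, hpq⟩ := hRec.exists_mem_of_minimal (T.prodCongr S) hM
    (W := ((T ^ a) ⁻¹' U) ×ˢ ((S ^ b) ⁻¹' V))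
    ((hU.preimage (T ^ a).continuous).prod (hV.preimage (S ^ b).continuous))
    ⟨(x, y), hxy, ha, hb⟩
  have hmem (j : ℕ) (hj : j ≤ ℓ) :
      T^[j * n] ((T ^ a) p) ∈ U ∧ S^[j * n] ((S ^ b) q) ∈ V := by
    simpa [Prod.map_iterate, zpow_iterate_apply_comm] using hpq j hj
  rw [hunion] at hn
  rcases hn with hn | hn
  · exact hA ⟨n, hn, hn1, _, fun j hj => (hmem j hj).1⟩
  · exact hB ⟨n, hn, hn1, _, fun j hj => (hmem j hj).2⟩
end

section
/- The family of sets of pointwise recurrence for minimal distal systems has the Ramsey property: if A and B are sets of positive integers such that for every minimal distal system (X,T) and every x ∈ X one has inf_{n ∈ A ∪ B} d(T^n x, x) = 0, then either for every minimal distal system (X,T) and every x ∈ X one has inf_{n ∈ A} d(T^n x, x) = 0, or for every minimal distal system (X,T) and every x ∈ X one has inf_{n ∈ B} d(T^n x, x) = 0. -/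
open Set

/-- The closure, for pointwise convergence, of the positive iterates of `T`. -/
def positiveEnveloping {X : Type} [TopologicalSpace X] (T : X → X) : Set (X → X) :=
  closure (range fun n : ℕ => T^[n + 1])

section Enveloping

variable {X : Type} [TopologicalSpace X] {T : X → X}

theorem positiveEnveloping.self_mem : T ∈ positiveEnveloping T :=
  subset_closure ⟨0, rfl⟩

theorem positiveEnveloping.comp_mem (hT : Continuous T) {f g : X → X}
    (hf : f ∈ positiveEnveloping T) (hg : g ∈ positiveEnveloping T) :
    f ∘ g ∈ positiveEnveloping T := by
  have iterate_comp (n : ℕ) : T^[n + 1] ∘ g ∈ positiveEnveloping T := by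
    have hc : Continuous fun h : X → X => T^[n + 1] ∘ h :=
      continuous_pi fun x => (hT.iterate (n + 1)).comp (continuous_apply x)
    refine map_mem_closure hc hg ?_
    rintro _ ⟨m, rfl⟩
    exact ⟨n + 1 + m, by rw [← Function.iterate_add]; rfl⟩
  have hc : Continuous fun h : X → X => h ∘ g :=
    continuous_pi fun x => continuous_apply (g x)
  have := map_mem_closure (t := positiveEnveloping T) hc hf
    (by rintro _ ⟨n, rfl⟩; exact iterate_comp n)
  rwa [positiveEnveloping, closure_closure] at this

theorem positiveEnveloping.mapsTo {f : X → X} (hf : f ∈ positiveEnveloping T) {K : Set X}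
    (hK : IsClosed K) (hTK : MapsTo T K K) : MapsTo f K K := by
  intro x hx
  have := map_mem_closure (continuous_apply x) hf (t := K)
    (by rintro _ ⟨n, rfl⟩; exact hTK.iterate (n + 1) hx)
  rwa [hK.closure_eq] at this

end Enveloping

namespace IsDistal

variable {X : Type} [MetricSpace X] {T : X → X}

/-- Distal maps do not identify points in the limit. -/
theorem injective_of_mem_positiveEnveloping (hd : IsDistal T) {f : X → X}
    (hf : f ∈ positiveEnveloping T) : Function.Injective f := by
  intro x y hxy
  by_contra hne
  obtain ⟨ε, hε, h⟩ := hd x y hne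
  have hclosed : IsClosed {g : X → X | ε ≤ dist (g x) (g y)} :=
    isClosed_le continuous_const ((continuous_apply x).dist (continuous_apply y))
  have hmem : f ∈ {g : X → X | ε ≤ dist (g x) (g y)} :=
    closure_minimal (by rintro _ ⟨n, rfl⟩; exact h (n + 1) (by omega)) hclosed hf
  rw [mem_ofPred_eq, hxy, dist_self] at hmem
  exact absurd hmem hε.not_ge

/-- In a compact distal system, a point whose orbit accumulates in a closed forward invariant set
lies in that set. -/
theorem mem_of_apply_mem [CompactSpace X] (hd : IsDistal T) (hT : Continuous T) {f : X → X}
    (hf : f ∈ positiveEnveloping T) {K : Set X} (hK : IsClosed K) (hTK : MapsTo T K K) {x : X}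
    (hx : f x ∈ K) : x ∈ K := by
  let _ : Semigroup (X → X) := { mul := fun g h => g ∘ h, mul_assoc := fun _ _ _ => rfl }
  obtain ⟨p, ⟨hp, hpx⟩, hpp⟩ := exists_idempotent_in_compact_subsemigroup
    (M := X → X) (fun g => continuous_pi fun y => continuous_apply (g y))
    (positiveEnveloping T ∩ {g | g x ∈ K}) ⟨f, hf, hx⟩
    (isClosed_closure.inter (hK.preimage (continuous_apply x))).isCompact
    (fun g hg h hh => ⟨positiveEnveloping.comp_mem hT hg.1 hh.1,
      positiveEnveloping.mapsTo hg.1 hK hTK hh.2⟩)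
  have : p x = x := hd.injective_of_mem_positiveEnveloping hp (congrFun hpp x)
  rwa [mem_ofPred_eq, this] at hpx

/-- Every point of a compact distal system lies in a minimal closed invariant set. -/
theorem exists_minimal_mem [CompactSpace X] (T : X ≃ₜ X) (hd : IsDistal T) (x : X) :
    ∃ Z : Set X, x ∈ Z ∧ IsClosed Z ∧ (∀ y, y ∈ Z ↔ T y ∈ Z) ∧
      ∀ K ⊆ Z, IsClosed K → K.Nonempty → MapsTo T K K → K = Z := by
  set Z : Set X := (fun f : X → X => f x) '' positiveEnveloping T with hZ
  have hclosed : IsClosed Z :=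
    ((isClosed_closure.isCompact (s := positiveEnveloping T)).image
      (continuous_apply x)).isClosed
  have hmaps : MapsTo T Z Z := by
    rintro _ ⟨f, hf, rfl⟩
    exact ⟨_, positiveEnveloping.comp_mem T.continuous positiveEnveloping.self_mem hf, rfl⟩
  have hne : Z.Nonempty := ⟨T x, T, positiveEnveloping.self_mem, rfl⟩
  have hmem : ∀ K ⊆ Z, IsClosed K → K.Nonempty → MapsTo T K K → x ∈ K := by
    rintro K hKZ hK ⟨y, hy⟩ hTK
    obtain ⟨f, hf, rfl⟩ := hKZ hy
    exact hd.mem_of_apply_mem T.continuous hf hK hTK hy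
  have hmin : ∀ K ⊆ Z, IsClosed K → K.Nonempty → MapsTo T K K → K = Z := by
    intro K hKZ hK hKne hTK
    refine hKZ.antisymm ?_
    rintro _ ⟨f, hf, rfl⟩
    exact positiveEnveloping.mapsTo hf hK hTK (hmem K hKZ hK hKne hTK)
  refine ⟨Z, hmem Z subset_rfl hclosed hne hmaps, hclosed, fun y => ⟨fun h => hmaps h, ?_⟩, hmin⟩
  intro hy
  have himage : T '' Z = Z := hmin _ hmaps.image_subset (T.isClosedMap _ hclosed)
    (hne.image T) (by rintro _ ⟨z, hz, rfl⟩; exact ⟨T z, hmaps hz, rfl⟩)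
  rw [← himage] at hy
  exact T.injective.mem_set_image.mp hy

theorem prodMap {Y : Type} [MetricSpace Y] {S : Y → Y} (hT : IsDistal T) (hS : IsDistal S) :
    IsDistal (Prod.map T S) := by
  rintro ⟨x, y⟩ ⟨x', y'⟩ hne
  simp only [Prod.map_iterate, Prod.map_apply, Prod.dist_eq, le_max_iff]
  by_cases hx : x = x'
  · obtain ⟨ε, hε, h⟩ := hS y y' fun hy => hne (by rw [hx, hy])
    exact ⟨ε, hε, fun n hn => Or.inr (h n hn)⟩
  · obtain ⟨ε, hε, h⟩ := hT x x' hx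
    exact ⟨ε, hε, fun n hn => Or.inl (h n hn)⟩

/-- A set of pointwise recurrence for minimal distal systems is one for all distal systems. -/
theorem exists_dist_iterate_lt {A : Set ℕ}
    (h : ∀ (X : Type) [MetricSpace X] [CompactSpace X] (T : X ≃ₜ X),
      IsMinimal (⇑T) → IsDistal (⇑T) → ∀ x : X, ∀ ε : ℝ, 0 < ε →
        ∃ n ∈ A, dist ((⇑T)^[n] x) x < ε)
    [CompactSpace X] (T : X ≃ₜ X) (hd : IsDistal T) (x : X) {ε : ℝ} (hε : 0 < ε) :
    ∃ n ∈ A, dist (T^[n] x) x < ε := by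
  obtain ⟨Z, hxZ, hZ, hTZ, hmin⟩ := exists_minimal_mem T hd x
  have : CompactSpace Z := isCompact_iff_compactSpace.mp hZ.isCompact
  let S : Z ≃ₜ Z := T.subtype hTZ
  have hS (n : ℕ) (z : Z) : ((S^[n] z : Z) : X) = T^[n] z :=
    Function.Semiconj.iterate_right (f := ((↑) : Z → X)) (fun _ => rfl) n z
  have hSmin : IsMinimal S := by
    intro K hK hKne hSK
    have hKZ : ((↑) : Z → X) '' K = Z := by
      refine hmin _ (Subtype.coe_image_subset Z K) (hZ.isClosedEmbedding_subtypeVal.isClosedMap K hK)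
        (hKne.image _) ?_
      rintro _ ⟨z, hz, rfl⟩
      exact ⟨S z, hSK ▸ mem_image_of_mem S hz, rfl⟩
    refine eq_univ_of_forall fun z => ?_
    exact Subtype.val_injective.mem_set_image.mp (hKZ.symm ▸ z.2)
  have hSd : IsDistal S := by
    intro y z hyz
    obtain ⟨δ, hδ, hδn⟩ := hd y z (Subtype.coe_injective.ne hyz)
    exact ⟨δ, hδ, fun n hn => by simpa only [Subtype.dist_eq, hS] using hδn n hn⟩
  obtain ⟨n, hn, hlt⟩ := h Z S hSmin hSd ⟨x, hxZ⟩ ε hε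
  exact ⟨n, hn, by simpa only [Subtype.dist_eq, hS] using hlt⟩

end IsDistal

/-- The family of sets of pointwise recurrence for minimal distal systems has the Ramsey
property: if `A ∪ B` is a set of pointwise recurrence for minimal distal systems, then so is
`A` or `B`. -/
theorem pointwise_recurrence_distal_ramsey (A B : Set ℕ)
    (h : ∀ (X : Type) [MetricSpace X] [CompactSpace X] (T : X ≃ₜ X),
      IsMinimal (⇑T) → IsDistal (⇑T) → ∀ x : X, ∀ ε : ℝ, 0 < ε →
        ∃ n ∈ A ∪ B, dist ((⇑T)^[n] x) x < ε) :
    (∀ (X : Type) [MetricSpace X] [CompactSpace X] (T : X ≃ₜ X),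
      IsMinimal (⇑T) → IsDistal (⇑T) → ∀ x : X, ∀ ε : ℝ, 0 < ε →
        ∃ n ∈ A, dist ((⇑T)^[n] x) x < ε) ∨
    (∀ (X : Type) [MetricSpace X] [CompactSpace X] (T : X ≃ₜ X),
      IsMinimal (⇑T) → IsDistal (⇑T) → ∀ x : X, ∀ ε : ℝ, 0 < ε →
        ∃ n ∈ B, dist ((⇑T)^[n] x) x < ε) := by
  by_contra! hcon
  obtain ⟨⟨X, _, _, T, -, hT, x, ε, hε, hA⟩, ⟨Y, _, _, S, -, hS, y, δ, hδ, hB⟩⟩ := hcon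
  obtain ⟨n, hn, hlt⟩ := IsDistal.exists_dist_iterate_lt h (T.prodCongr S)
    (hT.prodMap hS) (x, y) (lt_min hε hδ)
  rw [Homeomorph.coe_prodCongr, Prod.map_iterate, Prod.map_apply, Prod.dist_eq, max_lt_iff,
    lt_min_iff, lt_min_iff] at hlt
  rcases hn with hn | hn
  · exact (hA n hn).not_gt hlt.1.1
  · exact (hB n hn).not_gt hlt.2.2
end

section
/- Let s ≥ 2 and let M be the s×s real matrix with M_{i,i} = 1 for 1 ≤ i ≤ s, M_{i,i+1} = 1 for 1 ≤ i ≤ s−1, and all other entries 0. Then: (i) for every n ≥ 1 and every y ∈ ℝ^s with y_s = 0 there exists a unique x ∈ ℝ^s with x_1 = 0 and (M^n − Id)x = y; (ii) if moreover, for some k with 3 ≤ k ≤ s, y_i = 0 for all i ≥ s−k+2, then x_j = 0 for all j ≥ s−k+3; (iii) there exists a constant C > 0, depending only on s, such that for every n ≥ 1 and every κ > 0, if |y_i| ≤ κ/n^{i−1} for 1 ≤ i ≤ s−1, then the corresponding x satisfies |x_j| ≤ Cκ/n^{j−1} for 2 ≤ j ≤ s. -/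
open Finset in
/-- The entries of the powers of a Jordan block with eigenvalue 1 are binomial coefficients. -/
theorem jordan_block_pow_apply {s : ℕ} {M : Matrix (Fin s) (Fin s) ℝ}
    (hM : ∀ i j : Fin s, M i j = if (j : ℕ) = (i : ℕ) ∨ (j : ℕ) = (i : ℕ) + 1 then 1 else 0)
    (n : ℕ) (i j : Fin s) :
    (M ^ n) i j = if i ≤ j then (n.choose (j - i : ℕ) : ℝ) else 0 := by
  induction n generalizing i with
  | zero =>
    rcases lt_trichotomy i j with h | rfl | h
    · have h' : (j - i : ℕ) ≠ 0 := by rw [Fin.lt_def] at h; omega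
      simp [h.le, h.ne, Nat.choose_eq_zero_of_lt (Nat.pos_of_ne_zero h')]
    · simp
    · simp [h.not_ge, h.ne']
  | succ n ih =>
    rw [pow_succ', Matrix.mul_apply]
    by_cases hi : (i : ℕ) + 1 < s
    · have hsplit : ∀ k : Fin s, M i k * (M ^ n) k j =
          (if k = i then (M ^ n) k j else 0) +
            (if k = ⟨i + 1, hi⟩ then (M ^ n) k j else 0) := by
        intro k
        rw [hM]
        by_cases h₁ : k = i
        · subst h₁
          simp [Fin.ext_iff]
        · by_cases h₂ : k = ⟨i + 1, hi⟩
          · subst h₂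
            simp [Fin.ext_iff]
          · have h₁' := h₁
            have h₂' := h₂
            simp only [Fin.ext_iff] at h₁' h₂'
            simp [h₁, h₂, h₁', h₂']
      rw [sum_congr rfl fun k _ => hsplit k]
      simp only [sum_add_distrib, sum_ite_eq', mem_univ, if_true, ih]
      rcases lt_trichotomy i j with h | rfl | h
      · rw [Fin.lt_def] at h
        obtain ⟨d, hd⟩ := Nat.exists_eq_add_of_lt h
        rw [if_pos (by rw [Fin.le_def]; omega), if_pos (by rw [Fin.le_def]; simp; omega),
          if_pos (by rw [Fin.le_def]; omega), show (j - i : ℕ) = d + 1 by omega,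
          show (j - (⟨i + 1, hi⟩ : Fin s).val : ℕ) = d by simp; omega, Nat.choose_succ_succ]
        push_cast
        ring
      · simp [Fin.le_def]
      · have h' : ¬ (⟨i + 1, hi⟩ : Fin s) ≤ j := by
          rw [Fin.lt_def] at h; rw [Fin.le_def]; simp; omega
        simp [h.not_ge, h']
    · rw [sum_eq_single i]
      · rw [hM, if_pos (Or.inl rfl), one_mul, ih]
        by_cases h : i ≤ j
        · have h' : (j - i : ℕ) = 0 := by omega
          simp [h, h']
        · simp [h]
      · intro k _ hk
        rw [hM, if_neg, zero_mul]
        rintro (h | h)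
        · exact hk (Fin.ext h)
        · omega
      · simp

open Finset in
theorem jordan_block_pow_sub_one_mulVec {s : ℕ} {M : Matrix (Fin s) (Fin s) ℝ}
    (hM : ∀ i j : Fin s, M i j = if (j : ℕ) = (i : ℕ) ∨ (j : ℕ) = (i : ℕ) + 1 then 1 else 0)
    (n : ℕ) (x : Fin s → ℝ) (i : Fin s) :
    (M ^ n - 1).mulVec x i = ∑ l ∈ Ioi i, (n.choose (l - i : ℕ) : ℝ) * x l := by
  rw [Matrix.mulVec, dotProduct, ← sum_subset (subset_univ (Ioi i))]
  · refine sum_congr rfl fun l hl => ?_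
    rw [mem_Ioi] at hl
    simp [jordan_block_pow_apply hM, hl.le, hl.ne]
  · intro l _ hl
    rw [mem_Ioi, not_lt] at hl
    rcases hl.eq_or_lt with rfl | hl
    · simp [jordan_block_pow_apply hM]
    · simp [jordan_block_pow_apply hM, hl.not_ge, hl.ne']

open Finset in
/-- Back substitution: a bound on the rows of `(M ^ n - 1) x` from index `m` on bounds the
coordinates of `x` from index `m + 1` on, with a constant depending only on the size. -/
theorem jordan_block_exists_bound {s : ℕ} {M : Matrix (Fin s) (Fin s) ℝ}
    (hM : ∀ i j : Fin s, M i j = if (j : ℕ) = (i : ℕ) ∨ (j : ℕ) = (i : ℕ) + 1 then 1 else 0) :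
    ∃ C : ℝ, 0 < C ∧ ∀ n : ℕ, 1 ≤ n → ∀ κ : ℝ, 0 ≤ κ → ∀ (m : ℕ) (x : Fin s → ℝ),
      (∀ i : Fin s, m ≤ i → (i : ℕ) + 1 < s →
        |(M ^ n - 1).mulVec x i| ≤ κ / (n : ℝ) ^ (i : ℕ)) →
      ∀ j : Fin s, m + 1 ≤ j → |x j| ≤ C * κ / (n : ℝ) ^ (j : ℕ) := by
  suffices H : ∀ t : ℕ, ∃ C : ℝ, 0 < C ∧ ∀ n : ℕ, 1 ≤ n → ∀ κ : ℝ, 0 ≤ κ →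
      ∀ (m : ℕ) (x : Fin s → ℝ),
      (∀ i : Fin s, m ≤ i → (i : ℕ) + 1 < s →
        |(M ^ n - 1).mulVec x i| ≤ κ / (n : ℝ) ^ (i : ℕ)) →
      ∀ j : Fin s, m + 1 ≤ j → s ≤ j + t → |x j| ≤ C * κ / (n : ℝ) ^ (j : ℕ) by
    obtain ⟨C, hC, h⟩ := H s
    exact ⟨C, hC, fun n hn κ hκ m x hx j hj => h n hn κ hκ m x hx j hj (by omega)⟩
  intro t
  induction t with
  | zero => exact ⟨1, one_pos, fun n _ κ _ m x _ j _ hj => by omega⟩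
  | succ t ih =>
    obtain ⟨C, hC, ih⟩ := ih
    refine ⟨1 + s * C, by positivity, fun n hn κ hκ m x hx j hmj hjt => ?_⟩
    have hn0 : (0 : ℝ) < n := by exact_mod_cast hn
    have hj := j.isLt
    let i : Fin s := ⟨j - 1, by omega⟩
    have hij : (j : ℕ) = i + 1 := by simp only [i]; omega
    have hIoi : Ioi i = insert j (Ioi j) := by
      ext l
      simp only [mem_Ioi, mem_insert, Fin.lt_def, Fin.ext_iff]
      omega
    have hrow := jordan_block_pow_sub_one_mulVec hM n x i
    rw [hIoi, sum_insert (by simp), show (j - i : ℕ) = 1 by omega, Nat.choose_one_right] at hrow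
    have hy := hx i (by omega) (by omega)
    have hterm : ∀ l ∈ Ioi j, |(n.choose (l - i : ℕ) : ℝ) * x l| ≤ C * κ / (n : ℝ) ^ (i : ℕ) := by
      intro l hl
      rw [mem_Ioi, Fin.lt_def] at hl
      have hxl := ih n hn κ hκ m x hx l (by omega) (by omega)
      have hchoose : (n.choose (l - i : ℕ) : ℝ) ≤ (n : ℝ) ^ (l - i : ℕ) := by
        exact_mod_cast Nat.choose_le_pow n _
      rw [abs_mul, Nat.abs_cast]
      calc (n.choose (l - i : ℕ) : ℝ) * |x l|
          ≤ (n : ℝ) ^ (l - i : ℕ) * (C * κ / (n : ℝ) ^ (l : ℕ)) := by gcongr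
        _ = C * κ / (n : ℝ) ^ (i : ℕ) := by
          have hl' : (n : ℝ) ^ (l : ℕ) = (n : ℝ) ^ (l - i : ℕ) * (n : ℝ) ^ (i : ℕ) := by
            rw [← pow_add]; congr 1; omega
          rw [hl']
          field_simp
    have hsum : |∑ l ∈ Ioi j, (n.choose (l - i : ℕ) : ℝ) * x l| ≤
        s * (C * κ / (n : ℝ) ^ (i : ℕ)) := by
      refine (abs_sum_le_sum_abs _ _).trans ((sum_le_card_nsmul _ _ _ hterm).trans ?_)
      rw [nsmul_eq_mul]
      gcongr
      simpa using card_le_univ (Ioi j)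
    have hnx : (n : ℝ) * |x j| ≤ (1 + s * C) * κ / (n : ℝ) ^ (i : ℕ) := by
      have hxj : (n : ℝ) * x j = (M ^ n - 1).mulVec x i -
          ∑ l ∈ Ioi j, (n.choose (l - i : ℕ) : ℝ) * x l := by rw [hrow]; ring
      calc (n : ℝ) * |x j| = |(n : ℝ) * x j| := by rw [abs_mul, Nat.abs_cast]
        _ ≤ κ / (n : ℝ) ^ (i : ℕ) + s * (C * κ / (n : ℝ) ^ (i : ℕ)) := by
          rw [hxj]
          exact (abs_sub _ _).trans (add_le_add hy hsum)
        _ = (1 + s * C) * κ / (n : ℝ) ^ (i : ℕ) := by ring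
    rw [hij, pow_succ, ← div_div, le_div_iff₀ hn0, mul_comm]
    exact hnx

theorem jordan_block_eq_zero {s : ℕ} {M : Matrix (Fin s) (Fin s) ℝ}
    (hM : ∀ i j : Fin s, M i j = if (j : ℕ) = (i : ℕ) ∨ (j : ℕ) = (i : ℕ) + 1 then 1 else 0)
    {n : ℕ} (hn : 1 ≤ n) {m : ℕ} {x : Fin s → ℝ}
    (hx : ∀ i : Fin s, m ≤ i → (i : ℕ) + 1 < s → (M ^ n - 1).mulVec x i = 0)
    {j : Fin s} (hj : m + 1 ≤ j) : x j = 0 := by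
  obtain ⟨C, -, h⟩ := jordan_block_exists_bound hM
  simpa using h n hn 0 le_rfl m x (fun i hi hi' => by simp [hx i hi hi']) j hj


/-- Properties of the single `s × s` Jordan block `M` with eigenvalue 1 (1's on the diagonal
and superdiagonal): (i) for every `n ≥ 1` and `y` with last coordinate zero there is a unique
`x` with first coordinate zero and `(Mⁿ - Id)x = y`; (ii) if moreover `y_i = 0` for all
(1-based) `i ≥ s-k+2` (for some `3 ≤ k ≤ s`), then `x_j = 0` for all (1-based) `j ≥ s-k+3`;
(iii) there is `C > 0` depending only on `s` such that if `|y_i| ≤ κ/n^{i-1}` for (1-based)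
`1 ≤ i ≤ s-1`, then `|x_j| ≤ Cκ/n^{j-1}` for (1-based) `2 ≤ j ≤ s`.
Indices here are 0-based: the 1-based index `i` corresponds to the 0-based index `i - 1`. -/
theorem jordan_block_lemma (s : ℕ) (hs : 2 ≤ s) (M : Matrix (Fin s) (Fin s) ℝ)
    (hM : ∀ i j : Fin s, M i j = if (j : ℕ) = (i : ℕ) ∨ (j : ℕ) = (i : ℕ) + 1 then 1 else 0) :
    (∀ n : ℕ, 1 ≤ n → ∀ y : Fin s → ℝ, (∀ i : Fin s, (i : ℕ) = s - 1 → y i = 0) →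
      ∃! x : Fin s → ℝ, (∀ i : Fin s, (i : ℕ) = 0 → x i = 0) ∧
        (M ^ n - 1).mulVec x = y) ∧
    (∀ n : ℕ, 1 ≤ n → ∀ y : Fin s → ℝ, (∀ i : Fin s, (i : ℕ) = s - 1 → y i = 0) →
      ∀ k : ℕ, 3 ≤ k → k ≤ s → (∀ i : Fin s, s - k + 1 ≤ (i : ℕ) → y i = 0) →
        ∀ x : Fin s → ℝ, (∀ i : Fin s, (i : ℕ) = 0 → x i = 0) →
          (M ^ n - 1).mulVec x = y →
            ∀ j : Fin s, s - k + 2 ≤ (j : ℕ) → x j = 0) ∧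
    (∃ C : ℝ, 0 < C ∧ ∀ n : ℕ, 1 ≤ n → ∀ κ : ℝ, 0 < κ →
      ∀ y : Fin s → ℝ, (∀ i : Fin s, (i : ℕ) = s - 1 → y i = 0) →
        (∀ i : Fin s, (i : ℕ) ≤ s - 2 → |y i| ≤ κ / (n : ℝ) ^ (i : ℕ)) →
          ∀ x : Fin s → ℝ, (∀ i : Fin s, (i : ℕ) = 0 → x i = 0) →
            (M ^ n - 1).mulVec x = y →
              ∀ j : Fin s, 1 ≤ (j : ℕ) → |x j| ≤ C * κ / (n : ℝ) ^ (j : ℕ)) := by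
  refine ⟨fun n hn y hy => ?_, fun n hn y _ k hk hks hyk x _ hxy j hj => ?_, ?_⟩
  · let a : Fin s := ⟨0, by omega⟩
    let b : Fin s := ⟨s - 1, by omega⟩
    have hlast : ∀ x : Fin s → ℝ, (M ^ n - 1).mulVec x b = 0 := by
      intro x
      rw [jordan_block_pow_sub_one_mulVec hM]
      refine Finset.sum_eq_zero fun l hl => ?_
      rw [Finset.mem_Ioi, Fin.lt_def] at hl
      simp only [b] at hl
      omega
    have hker : ∀ x : Fin s → ℝ, x a = 0 →
        (∀ i : Fin s, (i : ℕ) + 1 < s → (M ^ n - 1).mulVec x i = 0) → x = 0 := by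
      intro x hxa hx
      funext j
      by_cases hj : (j : ℕ) = 0
      · rwa [show j = a from Fin.ext hj]
      · exact jordan_block_eq_zero hM hn (m := 0) (fun i _ => hx i) (by omega)
    let T : (Fin s → ℝ) →ₗ[ℝ] (Fin s → ℝ) :=
      (M ^ n - 1).mulVecLin + (LinearMap.single ℝ (fun _ => ℝ) b).comp (LinearMap.proj a)
    have hT : ∀ x, T x = (M ^ n - 1).mulVec x + Pi.single b (x a) := fun x => rfl
    have hTb : ∀ x, T x b = x a := fun x => by simp [hT, hlast]
    have hTi : ∀ x i, i ≠ b → T x i = (M ^ n - 1).mulVec x i := fun x i hi => by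
      simp [hT, hi]
    have hinj : Function.Injective T := by
      rw [injective_iff_map_eq_zero]
      intro x hx
      refine hker x (by rw [← hTb x, hx]; rfl) fun i hi => ?_
      rw [← hTi x i (by rw [ne_eq, Fin.ext_iff]; simp only [b]; omega), hx]
      rfl
    obtain ⟨x, hx⟩ := LinearMap.injective_iff_surjective.mp hinj y
    have hxa : x a = 0 := by rw [← hTb x, hx]; exact hy b rfl
    have hxy : (M ^ n - 1).mulVec x = y := by rw [← hx, hT, hxa]; simp
    refine ⟨x, ⟨fun i hi => by rwa [show i = a from Fin.ext hi], hxy⟩, ?_⟩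
    rintro z ⟨hz, hzy⟩
    rw [← sub_eq_zero]
    refine hker _ (by simp [hxa, hz a rfl]) fun i _ => ?_
    rw [Matrix.mulVec_sub, hzy, hxy, sub_self]
    rfl
  · exact jordan_block_eq_zero hM hn (m := s - k + 1)
      (fun i hi _ => by rw [hxy]; exact hyk i hi) hj
  · obtain ⟨C, hC, h⟩ := jordan_block_exists_bound hM
    refine ⟨C, hC, fun n hn κ hκ y _ hyκ x _ hxy j hj => ?_⟩
    exact h n hn κ hκ.le 0 x (fun i _ hi => by rw [hxy]; exact hyκ i (by omega)) j (by omega)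
end

section
/- Let r ≥ 2 and let R be a set of positive integers. Then R is r-large if and only if for every (not necessarily minimal) system (X,T), every cover of X by r open sets U₁, …, U_r, and every ℓ ≥ 2, there exist j ∈ {1, …, r} and n ∈ R such that n ∈ N^ℓ(U_j). -/
/-- `R` is `r`-large: for every partition (coloring) of the positive integers into `r` cells
and every length `ℓ ≥ 1`, some cell contains an arithmetic progression of length `ℓ` whose
common difference belongs to `R`. -/
def IsRLarge (r : ℕ) (R : Set ℕ) : Prop :=
  ∀ C : ℕ → Fin r, ∀ ℓ : ℕ, 1 ≤ ℓ →
    ∃ a n : ℕ, 1 ≤ a ∧ n ∈ R ∧ ∀ j < ℓ, C (a + j * n) = C a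

/-- The two-sided subshift of sequences whose central windows all occur in `C`. -/
def windowSubshift {r : ℕ} (C : ℕ → Fin r) : Set (ℤ → Fin r) :=
  {x | ∀ N : ℕ, ∃ a : ℕ, N < a ∧ ∀ k ∈ Finset.Icc (-N : ℤ) N, x k = C (a + k).toNat}

theorem isClosed_windowSubshift {r : ℕ} (C : ℕ → Fin r) : IsClosed (windowSubshift C) := by
  rw [windowSubshift, Set.ofPred_forall]
  refine isClosed_iInter fun N => ?_
  have h : Continuous fun (x : ℤ → Fin r) (k : Finset.Icc (-N : ℤ) N) => x k := by fun_prop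
  convert (isClosed_discrete {y : Finset.Icc (-N : ℤ) N → Fin r |
    ∃ a : ℕ, N < a ∧ ∀ k, y k = C (a + (k : ℤ)).toNat}).preimage h using 1
  ext x
  simp only [Set.mem_ofPred_eq, Set.mem_preimage, Subtype.forall]

theorem windowSubshift_nonempty {r : ℕ} (C : ℕ → Fin r) : (windowSubshift C).Nonempty := by
  have h : ∀ k : ℤ, ∃ i, ∀ᶠ a : ℕ in (Filter.hyperfilter ℕ : Filter ℕ),
      i = C (a + k).toNat := fun k => by
    have := Ultrafilter.eventually_exists_iff (f := Filter.hyperfilter ℕ)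
      (P := fun (i : Fin r) (a : ℕ) => i = C (a + k).toNat)
    exact this.1 (Filter.Eventually.of_forall fun a => ⟨_, rfl⟩)
  choose x hx using h
  refine ⟨x, fun N => ?_⟩
  have hN : ∀ᶠ a : ℕ in (Filter.hyperfilter ℕ : Filter ℕ), N < a :=
    Nat.hyperfilter_le_atTop (Filter.eventually_gt_atTop N)
  exact (hN.and ((Filter.eventually_all_finset _).2 fun k _ => hx k)).exists

theorem shift_mem_windowSubshift {r : ℕ} {C : ℕ → Fin r} {x : ℤ → Fin r}
    (hx : x ∈ windowSubshift C) {d : ℤ} (hd : |d| ≤ 1) :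
    (fun k => x (k + d)) ∈ windowSubshift C := by
  intro N
  obtain ⟨a, ha, h⟩ := hx (N + 1)
  rw [abs_le] at hd
  refine ⟨(a + d).toNat, by omega, fun k hk => ?_⟩
  rw [Finset.mem_Icc] at hk
  refine (h (k + d) (by rw [Finset.mem_Icc]; push_cast; omega)).trans ?_
  congr 1
  omega

theorem continuous_shift {r : ℕ} {C : ℕ → Fin r} (d : ℤ) :
    Continuous fun (x : windowSubshift C) (k : ℤ) => x.1 (k + d) :=
  continuous_pi fun k => (continuous_apply (k + d)).comp continuous_subtype_val

/-- The left shift on `windowSubshift C`. -/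
def windowShift {r : ℕ} (C : ℕ → Fin r) : windowSubshift C ≃ₜ windowSubshift C where
  toFun x := ⟨fun k => x.1 (k + 1), shift_mem_windowSubshift x.2 (by simp)⟩
  invFun x := ⟨fun k => x.1 (k + -1), shift_mem_windowSubshift x.2 (by simp)⟩
  left_inv x := by ext k; simp
  right_inv x := by ext k; simp
  continuous_toFun := Continuous.subtype_mk (continuous_shift 1) _
  continuous_invFun := Continuous.subtype_mk (continuous_shift (-1)) _

theorem windowShift_iterate_apply {r : ℕ} (C : ℕ → Fin r) (m : ℕ) (x : windowSubshift C)
    (k : ℤ) : ((windowShift C)^[m] x).1 k = x.1 (k + m) := by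
  induction m generalizing x with
  | zero => simp
  | succ m ih =>
    rw [Function.iterate_succ_apply, ih]
    simp [windowShift, add_assoc]

/-- `R` is `r`-large iff for every system `(X,T)`, every cover of `X` by `r` open sets
`U₁, …, U_r`, and every `ℓ ≥ 2`, there exist `j` and `n ∈ R` with `n ∈ N^ℓ(U_j)`. -/
theorem rLarge_iff_openCover (r : ℕ) (hr : 2 ≤ r) (R : Set ℕ) (hR : ∀ n ∈ R, 1 ≤ n) :
    IsRLarge r R ↔
      ∀ (X : Type) [MetricSpace X] [CompactSpace X] [Nonempty X] (T : X ≃ₜ X)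
        (U : Fin r → Set X),
        (∀ i, IsOpen (U i)) → (⋃ i, U i) = Set.univ →
          ∀ ℓ : ℕ, 2 ≤ ℓ → ∃ j : Fin r, ∃ n ∈ R, n ∈ RetTimes (⇑T) ℓ (U j) := by
  constructor
  · intro h X _ _ _ T U _ hcover ℓ _
    obtain ⟨x⟩ := ‹Nonempty X›
    choose C hC using fun n : ℕ => Set.iUnion_eq_univ_iff.1 hcover (T^[n] x)
    obtain ⟨a, n, -, hn, hmono⟩ := h C (ℓ + 1) (by omega)
    refine ⟨C a, n, hn, hR n hn, T^[a] x, fun j hj => ?_⟩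
    rw [← Function.iterate_add_apply, add_comm, ← hmono j (by omega)]
    exact hC _
  · intro h C ℓ _
    have : CompactSpace (windowSubshift C) :=
      isCompact_iff_compactSpace.1 (isClosed_windowSubshift C).isCompact
    have : Nonempty (windowSubshift C) := (windowSubshift_nonempty C).to_subtype
    let _ : MetricSpace (windowSubshift C) := TopologicalSpace.metrizableSpaceMetric _
    obtain ⟨i, n, hn, -, x, hx⟩ := h (windowSubshift C) (windowShift C)
      (fun i => (fun x => x.1 0) ⁻¹' {i})
      (fun i => (isOpen_discrete {i}).preimage
        ((continuous_apply (0 : ℤ)).comp continuous_subtype_val))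
      (Set.iUnion_eq_univ_iff.2 fun x => ⟨x.1 0, rfl⟩) (max ℓ 2) (le_max_right _ _)
    obtain ⟨a, ha, hwin⟩ := x.2 (ℓ * n)
    have hcol : ∀ j ≤ ℓ, C (a + j * n) = i := fun j hj => by
      have h0 := hx j (hj.trans (le_max_left _ _))
      rw [Set.mem_preimage, Set.mem_singleton_iff, windowShift_iterate_apply, zero_add] at h0
      have hle : j * n ≤ ℓ * n := Nat.mul_le_mul_right n hj
      rw [hwin _ (Finset.mem_Icc.2 ⟨by omega, by exact_mod_cast hle⟩)] at h0
      rw [← h0]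
      congr 1
    refine ⟨a, n, by omega, hn, fun j hj => ?_⟩
    have h0 := hcol 0 (Nat.zero_le _)
    rw [zero_mul, add_zero] at h0
    rw [hcol j hj.le, h0]
end

section
/- Let α ∈ ℝ/ℤ and ε > 0, and let S = {n ≥ 1 : ‖nα‖ > ε}, where ‖t‖ denotes the distance from t to the nearest integer. Then S is not 2-large: there exist a partition of the positive integers into two cells ℕ = C₁ ∪ C₂ and an integer ℓ (one may take ℓ = 1 + ⌈1/(2ε)⌉) such that neither cell contains an arithmetic progression of length ℓ whose common difference belongs to S. -/
/-- If the fractional parts of `u` and `v` lie in the same half of `[0, 1)`, their difference is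
the representative of `v - u` modulo `1` that is nearest to `0`. -/
theorem fract_sub_fract_eq_sub_round {u v : ℝ}
    (h : Int.fract u < 1 / 2 ↔ Int.fract v < 1 / 2) :
    Int.fract v - Int.fract u = (v - u) - round (v - u) := by
  have hu0 := Int.fract_nonneg u
  have hu1 := Int.fract_lt_one u
  have hv0 := Int.fract_nonneg v
  have hv1 := Int.fract_lt_one v
  have hd : |Int.fract v - Int.fract u| < 1 / 2 := by
    rw [abs_lt]
    by_cases hu : Int.fract u < 1 / 2
    · have hv := h.1 hu
      constructor <;> linarith
    · have hv := mt h.2 hu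
      constructor <;> linarith
  have ht := abs_le.1 (abs_sub_round (v - u))
  rw [abs_lt] at hd
  have hfu := Int.floor_add_fract u
  have hfv := Int.floor_add_fract v
  have hlt : round (v - u) - (⌊v⌋ - ⌊u⌋) < 1 := by
    have : ((round (v - u) - (⌊v⌋ - ⌊u⌋) : ℤ) : ℝ) < 1 := by
      push_cast
      linarith
    exact_mod_cast this
  have hgt : -1 < round (v - u) - (⌊v⌋ - ⌊u⌋) := by
    have : (-1 : ℝ) < ((round (v - u) - (⌊v⌋ - ⌊u⌋) : ℤ) : ℝ) := by
      push_cast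
      linarith
    exact_mod_cast this
  have heq : round (v - u) = ⌊v⌋ - ⌊u⌋ := by omega
  rw [heq]
  push_cast
  linarith


/-- For `α ∈ ℝ/ℤ` and `ε > 0`, the set `S = {n ≥ 1 : ‖nα‖ > ε}` is not 2-large: there are a
2-coloring of the positive integers and a length `ℓ` such that no cell contains an
arithmetic progression of length `ℓ` whose common difference lies in `S`.
(Here `‖·‖` is the norm on `ℝ/ℤ`, the distance to the nearest integer.) -/
theorem not_two_large (α : AddCircle (1 : ℝ)) (ε : ℝ) (hε : 0 < ε) :
    ∃ (C : ℕ → Fin 2) (ℓ : ℕ),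
      ¬ ∃ a n : ℕ, 1 ≤ a ∧ n ∈ {n : ℕ | 1 ≤ n ∧ ε < ‖n • α‖} ∧
          ∀ j < ℓ, C (a + j * n) = C a := by
  obtain ⟨x, rfl⟩ := QuotientAddGroup.mk_surjective α
  refine ⟨fun m => if Int.fract (m * x) < 1 / 2 then 0 else 1, ⌈1 / (2 * ε)⌉₊ + 1, ?_⟩
  rintro ⟨a, n, -, ⟨-, hn⟩, hC⟩
  set t : ℝ := n * x - round (n * x) with ht
  have hnorm : ε < |t| := by
    have h : n • (QuotientAddGroup.mk x : AddCircle (1 : ℝ)) =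
        ((n * x : ℝ) : AddCircle (1 : ℝ)) := by
      rw [← nsmul_eq_mul]
      rfl
    rw [h, AddCircle.norm_eq] at hn
    simpa [ht] using hn
  have hiff : ∀ j < ⌈1 / (2 * ε)⌉₊ + 1,
      (Int.fract (((a + j * n : ℕ) : ℝ) * x) < 1 / 2 ↔ Int.fract ((a : ℝ) * x) < 1 / 2) := by
    intro j hj
    have h := hC j hj
    dsimp only at h
    split_ifs at h with h1 h2 h2
    · exact iff_of_true h1 h2
    · exact absurd h (by decide)
    · exact absurd h (by decide)
    · exact iff_of_false h1 h2
  have hstep : ∀ j < ⌈1 / (2 * ε)⌉₊ + 1,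
      Int.fract (((a + j * n : ℕ) : ℝ) * x) = Int.fract ((a : ℝ) * x) + j * t := by
    intro j
    induction j with
    | zero => simp
    | succ k ih =>
      intro hk
      have h := fract_sub_fract_eq_sub_round ((hiff k (by omega)).trans (hiff (k + 1) hk).symm)
      have hsub : ((a + (k + 1) * n : ℕ) : ℝ) * x - ((a + k * n : ℕ) : ℝ) * x = n * x := by
        push_cast
        ring
      rw [hsub, ← ht, ih (by omega)] at h
      push_cast at h ⊢
      linarith
  set N := ⌈1 / (2 * ε)⌉₊ with hN
  have hlast := hstep N (by omega)
  have hlarge : 1 / 2 < (N : ℝ) * |t| := by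
    have h1 : 1 / (2 * ε) ≤ (N : ℝ) := Nat.le_ceil _
    have h0 : 0 < 1 / (2 * ε) := by positivity
    calc (1 / 2 : ℝ) = 1 / (2 * ε) * ε := by field_simp
      _ < 1 / (2 * ε) * |t| := by gcongr
      _ ≤ N * |t| := by gcongr
  have hsmall : |(N : ℝ) * t| < 1 / 2 := by
    have h := hiff N (by omega)
    have h1 := Int.fract_nonneg (((a + N * n : ℕ) : ℝ) * x)
    have h2 := Int.fract_lt_one (((a + N * n : ℕ) : ℝ) * x)
    have h3 := Int.fract_nonneg ((a : ℝ) * x)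
    have h4 := Int.fract_lt_one ((a : ℝ) * x)
    rw [abs_lt]
    by_cases hu : Int.fract ((a : ℝ) * x) < 1 / 2
    · have hv := h.2 hu
      constructor <;> linarith
    · have hv := mt h.1 hu
      constructor <;> linarith
  rw [abs_mul, Nat.abs_cast] at hsmall
  linarith
end

section
/- Let r₁, r₂ ≥ 2 and let S₁, S₂ be sets of positive integers. If S₁ ∪ S₂ is (r₁·r₂)-large, then S₁ is r₁-large or S₂ is r₂-large. -/
/-- If `S₁ ∪ S₂` is `(r₁·r₂)`-large then `S₁` is `r₁`-large or `S₂` is `r₂`-large. -/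
theorem rLarge_union_split (r₁ r₂ : ℕ) (hr₁ : 2 ≤ r₁) (hr₂ : 2 ≤ r₂)
    (S₁ S₂ : Set ℕ) (hS₁ : ∀ n ∈ S₁, 1 ≤ n) (hS₂ : ∀ n ∈ S₂, 1 ≤ n)
    (h : IsRLarge (r₁ * r₂) (S₁ ∪ S₂)) :
    IsRLarge r₁ S₁ ∨ IsRLarge r₂ S₂ := by
  by_contra! hcon
  obtain ⟨h₁, h₂⟩ := hcon
  simp only [IsRLarge, not_forall] at h₁ h₂
  obtain ⟨C₁, ℓ₁, hℓ₁, h₁⟩ := h₁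
  obtain ⟨C₂, ℓ₂, -, h₂⟩ := h₂
  obtain ⟨a, n, ha, hn, hC⟩ :=
    h (fun x => finProdFinEquiv (C₁ x, C₂ x)) (max ℓ₁ ℓ₂) (le_max_of_le_left hℓ₁)
  simp only [EmbeddingLike.apply_eq_iff_eq, Prod.mk.injEq] at hC
  rcases hn with hn | hn
  · exact h₁ ⟨a, n, ha, hn, fun j hj => (hC j (lt_max_of_lt_left hj)).1⟩
  · exact h₂ ⟨a, n, ha, hn, fun j hj => (hC j (lt_max_of_lt_right hj)).2⟩
end

section
/- Let d ≥ 1 and r ≥ 2. Let E be a Bohr₀ set of dimension at most d, i.e. there exist α₁, …, α_d ∈ ℝ/ℤ and ε > 0 such that {n ≥ 1 : ‖nα₁‖ < ε, …, ‖nα_d‖ < ε} ⊆ E. If S is a (2^d·r)-large set of positive integers, then S ∩ E is r-large. -/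
/-- If the parity of `⌊2 * y⌋` is constant along the progression `x, x + t, …, x + L * t`, then
`t` is within `1 / (2 * L)` of an integer. -/
theorem mul_abs_sub_round_lt_of_even_floor_iff (x t : ℝ) (L : ℕ)
    (h : ∀ j ≤ L, (Even ⌊2 * (x + j * t)⌋ ↔ Even ⌊2 * x⌋)) :
    L * |t - round t| < 1 / 2 := by
  have hb := abs_le.mp (abs_sub_round t)
  set b : ℝ := t - round t with hbdef
  have parity : ∀ j ≤ L, (Even ⌊2 * (x + j * b)⌋ ↔ Even ⌊2 * x⌋) := by
    intro j hj
    have hshift : 2 * (x + j * b) = 2 * (x + j * t) - ((2 * (j * round t) : ℤ) : ℝ) := by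
      rw [hbdef]; push_cast; ring
    rw [hshift, Int.floor_sub_intCast, Int.even_sub, ← h j hj]
    simp
  have floor_eq : ∀ j ≤ L, ⌊2 * (x + j * b)⌋ = ⌊2 * x⌋ := by
    intro j
    induction j with
    | zero => simp
    | succ k ih =>
      intro hk
      have hp := parity (k + 1) hk
      have hprev := ih (by omega)
      have h1 := Int.floor_le (2 * (x + k * b))
      have h2 := Int.lt_floor_add_one (2 * (x + k * b))
      have h3 := Int.floor_le (2 * (x + (k + 1 : ℕ) * b))
      have h4 := Int.lt_floor_add_one (2 * (x + (k + 1 : ℕ) * b))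
      rw [hprev] at h1 h2
      generalize ⌊2 * (x + (k + 1 : ℕ) * b)⌋ = m at *
      generalize ⌊2 * x⌋ = n at *
      push_cast at h3 h4
      have hlt : m < n + 2 := by
        have : (m : ℝ) < n + 2 := by linarith
        exact_mod_cast this
      have hgt : n < m + 2 := by
        have : (n : ℝ) < m + 2 := by linarith
        exact_mod_cast this
      rw [Int.even_iff, Int.even_iff] at hp
      omega
  have hdist := Int.abs_sub_lt_one_of_floor_eq_floor (floor_eq L le_rfl)
  rw [show 2 * (x + L * b) - 2 * x = 2 * (L * b) by ring, abs_mul, abs_mul, Nat.abs_cast,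
    abs_two] at hdist
  linarith

/-- If `E` is a Bohr₀ set of dimension at most `d` (it contains
`{n ≥ 1 : ‖nα₁‖ < ε, …, ‖nα_d‖ < ε}` for some `α₁, …, α_d ∈ ℝ/ℤ` and `ε > 0`) and `S` is a
`(2^d·r)`-large set of positive integers, then `S ∩ E` is `r`-large. -/
theorem bohr_inter_large (d r : ℕ) (hd : 1 ≤ d) (hr : 2 ≤ r) (E : Set ℕ)
    (hE : ∃ (α : Fin d → AddCircle (1 : ℝ)) (ε : ℝ), 0 < ε ∧
      {n : ℕ | 1 ≤ n ∧ ∀ i : Fin d, ‖n • α i‖ < ε} ⊆ E)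
    (S : Set ℕ) (hS : ∀ n ∈ S, 1 ≤ n) (hSlarge : IsRLarge (2 ^ d * r) S) :
    IsRLarge r (S ∩ E) := by
  obtain ⟨α, ε, hε, hsub⟩ := hE
  choose a ha using fun i => QuotientAddGroup.mk_surjective (α i)
  intro C ℓ hℓ
  obtain ⟨L, hL⟩ := exists_nat_gt (1 / (2 * ε))
  let e : (Fin d → Bool) × Fin r ≃ Fin (2 ^ d * r) := Fintype.equivFinOfCardEq (by simp)
  obtain ⟨m, n, hm, hn, hmono⟩ := hSlarge
    (fun k => e (fun i => decide (Even ⌊2 * (k * a i)⌋), C k)) (ℓ + L) (by omega)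
  simp only [e.apply_eq_iff_eq, Prod.mk.injEq, funext_iff, decide_eq_decide] at hmono
  refine ⟨m, n, hm, ⟨hn, hsub ⟨hS n hn, fun i => ?_⟩⟩, fun j hj => (hmono j (by omega)).2⟩
  have hround := mul_abs_sub_round_lt_of_even_floor_iff (m * a i) (n * a i) L fun j hj => by
    rw [← (hmono j (by omega)).1 i]
    push_cast
    ring_nf
  have hnorm : ‖n • α i‖ = |n * a i - round (n * a i)| := by
    rw [← UnitAddCircle.norm_eq, ← ha i, ← nsmul_eq_mul]
    rfl
  rw [hnorm]
  rw [div_lt_iff₀ (by positivity)] at hL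
  by_contra! hle
  have := mul_le_mul_of_nonneg_left hle (Nat.cast_nonneg (α := ℝ) L)
  linarith
end

section
/- Let ℓ ≥ 1 be an integer, let 0 < δ ≤ 1/2, let α ∈ ℝ/ℤ, and set R = {n ≥ 1 : ‖n^ℓ α‖ > δ} and m = ⌈2^{ℓ−1}/δ⌉, where ‖t‖ denotes the distance from t to the nearest integer. Then R is not m-large: there exist a partition of the positive integers into m cells and a length L such that no cell contains an arithmetic progression of length L whose common difference belongs to R. -/
open Finset fwdDiff in
/-- The `ℓ`-th finite difference of the constant function `1` vanishes for `ℓ ≥ 1`. -/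
theorem sum_neg_one_pow_sub_mul_choose_eq_zero {ℓ : ℕ} (hℓ : 1 ≤ ℓ) :
    ∑ k ∈ range (ℓ + 1), (-1 : ℤ) ^ (ℓ - k) * ℓ.choose k = 0 := by
  have h := congrFun (fwdDiff_iter_pow_eq_zero_of_lt (R := ℤ) (Nat.lt_of_succ_le hℓ)) 0
  rw [fwdDiff_iter_eq_sum_shift] at h
  simpa using h

open Finset fwdDiff Nat in
/-- The `ℓ`-th finite difference with step `n` of the `ℓ`-th power is `ℓ! * n ^ ℓ`. -/
theorem sum_neg_one_pow_sub_mul_choose_mul_add_mul_pow {K : Type*} [Field K] (ℓ : ℕ) (a : K)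
    {n : K} (hn : n ≠ 0) :
    ∑ k ∈ range (ℓ + 1), (((-1 : ℤ) ^ (ℓ - k) * ℓ.choose k : ℤ) : K) * (a + k * n) ^ ℓ =
      ℓ ! * n ^ ℓ := by
  have h := congrFun (fwdDiff_iter_eq_factorial (R := K) (n := ℓ)) (a / n)
  rw [fwdDiff_iter_eq_sum_shift] at h
  rw [Pi.natCast_apply] at h
  rw [← h, sum_mul]
  refine sum_congr rfl fun k _ => ?_
  rw [zsmul_eq_mul, mul_assoc, ← mul_pow, nsmul_one, add_mul, div_mul_cancel₀ _ hn]

open Finset in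
/-- If the fractional parts of `z 0, …, z ℓ` all lie within `ε` of a common point, then the
`ℓ`-th finite difference of `z` is within `2 ^ ℓ * ε` of an integer. -/
theorem UnitAddCircle.norm_coe_sum_neg_one_pow_sub_mul_choose_mul_le {ℓ : ℕ} (hℓ : 1 ≤ ℓ)
    (z : ℕ → ℝ) (c ε : ℝ) (hz : ∀ k ≤ ℓ, |Int.fract (z k) - c| ≤ ε) :
    ‖((∑ k ∈ range (ℓ + 1), (((-1 : ℤ) ^ (ℓ - k) * ℓ.choose k : ℤ) : ℝ) * z k : ℝ) :
      UnitAddCircle)‖ ≤ 2 ^ ℓ * ε := by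
  have hzero : ∑ k ∈ range (ℓ + 1), (((-1 : ℤ) ^ (ℓ - k) * ℓ.choose k : ℤ) : ℝ) = 0 := by
    exact_mod_cast sum_neg_one_pow_sub_mul_choose_eq_zero hℓ
  have hsplit : (∑ k ∈ range (ℓ + 1), (((-1 : ℤ) ^ (ℓ - k) * ℓ.choose k : ℤ) : ℝ) * z k) -
      ((∑ k ∈ range (ℓ + 1), ((-1 : ℤ) ^ (ℓ - k) * ℓ.choose k) * ⌊z k⌋ : ℤ) : ℝ) =
      ∑ k ∈ range (ℓ + 1), (((-1 : ℤ) ^ (ℓ - k) * ℓ.choose k : ℤ) : ℝ) *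
        (Int.fract (z k) - c) := by
    simp_rw [mul_sub]
    rw [sum_sub_distrib, ← sum_mul, hzero, zero_mul, sub_zero, Int.cast_sum, ← sum_sub_distrib]
    refine sum_congr rfl fun k _ => ?_
    rw [Int.cast_mul _ ⌊z k⌋, ← mul_sub, Int.self_sub_floor]
  rw [UnitAddCircle.norm_eq]
  refine (round_le _ _).trans (hsplit ▸ (abs_sum_le_sum_abs _ _).trans ?_)
  have hsum : (2 : ℝ) ^ ℓ = ∑ k ∈ range (ℓ + 1), (ℓ.choose k : ℝ) := by
    exact_mod_cast (Nat.sum_range_choose ℓ).symm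
  rw [hsum, sum_mul]
  refine sum_le_sum fun k hk => ?_
  rw [abs_mul]
  have hw : |(((-1 : ℤ) ^ (ℓ - k) * ℓ.choose k : ℤ) : ℝ)| = ℓ.choose k := by
    simp [abs_mul]
  rw [hw]
  exact mul_le_mul_of_nonneg_left (hz k (by simpa [Nat.lt_succ_iff] using hk)) (Nat.cast_nonneg _)

/-- A real number in the `c`-th of the intervals of length `1 / m` lies within `1 / (2 * m)` of
the midpoint of that interval. -/
theorem abs_sub_midpoint_le_of_floor_mul_eq {m : ℕ} (hm : 0 < m) {x : ℝ} (hx : 0 ≤ x) {c : ℕ}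
    (h : ⌊m * x⌋₊ = c) : |x - (c + 1 / 2) / m| ≤ 1 / (2 * m) := by
  have hm' : (0 : ℝ) < m := Nat.cast_pos.2 hm
  obtain ⟨h₁, h₂⟩ := (Nat.floor_eq_iff (by positivity)).1 h
  have : x - (c + 1 / 2) / m = (m * x - c - 1 / 2) / m := by field_simp; ring
  rw [this, abs_div, abs_of_pos hm', ← div_div]
  gcongr
  rw [abs_le]
  constructor <;> linarith

/-- For `ℓ ≥ 1`, `0 < δ ≤ 1/2`, `α ∈ ℝ/ℤ`, the set `R = {n ≥ 1 : ‖n^ℓ α‖ > δ}` is not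
`m`-large for `m = ⌈2^{ℓ-1}/δ⌉`: there are an `m`-coloring of the positive integers and a
length `L` such that no cell contains an arithmetic progression of length `L` with common
difference in `R`. (Here `‖·‖` is the norm on `ℝ/ℤ`, the distance to the nearest integer.) -/
theorem affine_not_m_large (ℓ : ℕ) (hℓ : 1 ≤ ℓ) (δ : ℝ) (hδ0 : 0 < δ) (hδ : δ ≤ 1 / 2)
    (α : AddCircle (1 : ℝ)) :
    ∃ (C : ℕ → Fin ⌈(2 : ℝ) ^ (ℓ - 1) / δ⌉₊) (L : ℕ),
      ¬ ∃ a n : ℕ, 1 ≤ a ∧ n ∈ {n : ℕ | 1 ≤ n ∧ δ < ‖(n ^ ℓ) • α‖} ∧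
          ∀ j < L, C (a + j * n) = C a := by
  have hm : 0 < ⌈(2 : ℝ) ^ (ℓ - 1) / δ⌉₊ := Nat.ceil_pos.2 (by positivity)
  have hle : (2 : ℝ) ^ (ℓ - 1) / δ ≤ ⌈(2 : ℝ) ^ (ℓ - 1) / δ⌉₊ := Nat.le_ceil _
  generalize ⌈(2 : ℝ) ^ (ℓ - 1) / δ⌉₊ = m at hm hle
  have hm' : (0 : ℝ) < m := Nat.cast_pos.2 hm
  obtain ⟨x, rfl⟩ := QuotientAddGroup.mk_surjective α
  have hfac : (ℓ.factorial : ℝ) ≠ 0 := Nat.cast_ne_zero.2 ℓ.factorial_ne_zero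
  let z : ℕ → ℝ := fun n => x / ℓ.factorial * (n : ℝ) ^ ℓ
  have hlt (n : ℕ) : ⌊m * Int.fract (z n)⌋₊ < m := by
    rw [Nat.floor_lt (by have := Int.fract_nonneg (z n); positivity)]
    exact mul_lt_of_lt_one_right hm' (Int.fract_lt_one _)
  refine ⟨fun n => ⟨⌊m * Int.fract (z n)⌋₊, hlt n⟩, ℓ + 1, ?_⟩
  rintro ⟨a, n, -, ⟨hn, hδn⟩, hC⟩
  refine hδn.not_ge ?_
  have hdiff := sum_neg_one_pow_sub_mul_choose_mul_add_mul_pow ℓ (a : ℝ)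
    (n := (n : ℝ)) (Nat.cast_ne_zero.2 (by omega))
  have hnorm := UnitAddCircle.norm_coe_sum_neg_one_pow_sub_mul_choose_mul_le hℓ
    (fun k => z (a + k * n)) _ _ fun k hk =>
      abs_sub_midpoint_le_of_floor_mul_eq hm (Int.fract_nonneg _)
        (Fin.mk.inj_iff.1 (hC k (Nat.lt_succ_of_le hk)))
  have hsum : ∑ k ∈ Finset.range (ℓ + 1),
      (((-1 : ℤ) ^ (ℓ - k) * ℓ.choose k : ℤ) : ℝ) * z (a + k * n) = (n ^ ℓ) • x := by
    simp only [z, Nat.cast_add, Nat.cast_mul, mul_left_comm _ (x / (ℓ.factorial : ℝ))]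
    rw [← Finset.mul_sum, hdiff, nsmul_eq_mul, Nat.cast_pow]
    field_simp
  rw [hsum] at hnorm
  refine hnorm.trans ?_
  rw [div_le_iff₀ hδ0] at hle
  obtain ⟨k, rfl⟩ := Nat.exists_eq_add_of_le' hℓ
  rw [Nat.add_sub_cancel] at hle
  rw [mul_one_div, div_le_iff₀ (by positivity), pow_succ]
  linarith
end

section
/- Let r ≥ 2. Then: (i) every r-large set of positive integers is r-syndetic large; (ii) every (2r−1)-syndetic large set of positive integers is r-large. -/
/-- `E` is syndetic with syndeticity constant at most `r`: every interval of `r` consecutive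
positive integers contains an element of `E`. -/
def SyndeticConst (r : ℕ) (E : Set ℕ) : Prop :=
  ∀ a : ℕ, 1 ≤ a → ∃ m ∈ E, a ≤ m ∧ m < a + r

/-- `S` is `r`-syndetic large: every syndetic set of positive integers with syndeticity
constant at most `r` contains, for every `ℓ ≥ 1`, an arithmetic progression of length `ℓ`
whose common difference belongs to `S`. -/
def IsRSyndeticLarge (r : ℕ) (S : Set ℕ) : Prop :=
  ∀ E : Set ℕ, (∀ n ∈ E, 1 ≤ n) → SyndeticConst r E →
    ∀ ℓ : ℕ, 1 ≤ ℓ → ∃ a n : ℕ, 1 ≤ a ∧ n ∈ S ∧ ∀ j < ℓ, a + j * n ∈ E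

/-- Coloring `n` by the distance from `n` to the next element of `E` turns monochromatic
progressions into translates of progressions in `E`. -/
theorem IsRLarge.isRSyndeticLarge {r : ℕ} (hr : 0 < r) {S : Set ℕ} (h : IsRLarge r S) :
    IsRSyndeticLarge r S := by
  intro E _ hE ℓ hℓ
  have key : ∀ n : ℕ, ∃ i : Fin r, 1 ≤ n → n + i ∈ E := by
    intro n
    by_cases hn : 1 ≤ n
    · obtain ⟨m, hm, h1, h2⟩ := hE n hn
      refine ⟨⟨m - n, by omega⟩, fun _ => ?_⟩
      simpa [Nat.add_sub_cancel' h1] using hm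
    · exact ⟨⟨0, hr⟩, fun h => absurd h hn⟩
  choose C hC using key
  obtain ⟨a, n, ha, hn, hmono⟩ := h C ℓ hℓ
  refine ⟨a + C a, n, by omega, hn, fun j hj => ?_⟩
  have h1 := hC (a + j * n) (by omega)
  rw [hmono j hj] at h1
  rwa [add_right_comm]

/-- The color tested at a position `s` of a period: the word `0 1 ⋯ (r-1) * 0 1 ⋯ (r-1) 0 1 ⋯`,
where the hole `*` sits at position `r`. -/
def holedWord (r s : ℕ) : ℕ :=
  if s < r then s else (s - 1) % r

/-- Each period `[p * k, p * k + p)` encodes the color of `p * k + 1` repeatedly along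
`holedWord r`, leaving out the position `r` of the period. -/
def codingSet {r : ℕ} (p : ℕ) (C : ℕ → Fin r) : Set ℕ :=
  {n | 1 ≤ n ∧ n % p ≠ r ∧ (C (p * (n / p) + 1) : ℕ) = holedWord r (n % p)}

theorem mem_codingSet_of_period {r p : ℕ} {C : ℕ → Fin r} {k s : ℕ} (hs : s < p)
    (h1 : 1 ≤ p * k + s) (hsr : s ≠ r) (hC : (C (p * k + 1) : ℕ) = holedWord r s) :
    p * k + s ∈ codingSet p C := by
  have hm : (p * k + s) % p = s := by rw [Nat.mul_add_mod, Nat.mod_eq_of_lt hs]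
  have hd : (p * k + s) / p = k := by
    rw [Nat.mul_add_div (by omega), Nat.div_eq_of_lt hs, add_zero]
  refine ⟨h1, ?_, ?_⟩
  · rwa [hm]
  · rwa [hm, hd]

theorem exists_mod_eq_of_lt {r c : ℕ} (hc : c < r) (x : ℕ) :
    ∃ y, x ≤ y ∧ y < x + r ∧ y % r = c := by
  have hx := Nat.div_add_mod x r
  have hlt := Nat.mod_lt x (by omega : 0 < r)
  by_cases h : x % r ≤ c
  · exact ⟨r * (x / r) + c, by omega, by omega, by rw [Nat.mul_add_mod, Nat.mod_eq_of_lt hc]⟩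
  · refine ⟨r * (x / r + 1) + c, ?_, ?_, by rw [Nat.mul_add_mod, Nat.mod_eq_of_lt hc]⟩ <;>
      rw [mul_add] <;> omega

theorem syndeticConst_codingSet {r p : ℕ} (hr : 2 ≤ r) (hp : 2 * r + 1 ≤ p) (C : ℕ → Fin r) :
    SyndeticConst (2 * r - 1) (codingSet p C) := by
  intro a ha
  have hdiv := Nat.div_add_mod a p
  have hs := Nat.mod_lt a (by omega : 0 < p)
  set k := a / p
  set s := a % p
  have hc := (C (p * k + 1)).isLt
  set c : ℕ := (C (p * k + 1)).val
  by_cases hsr : s < r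
  · by_cases hcs : s ≤ c
    · refine ⟨p * k + c, mem_codingSet_of_period (by omega) (by omega) (by omega) ?_,
        by omega, by omega⟩
      rw [holedWord, if_pos hc]
    · refine ⟨p * k + (r + 1 + c), mem_codingSet_of_period (by omega) (by omega) (by omega) ?_,
        by omega, by omega⟩
      rw [holedWord, if_neg (by omega), show r + 1 + c - 1 = r + c by omega,
        Nat.add_mod_left, Nat.mod_eq_of_lt hc]
  · by_cases hend : max s (r + 1) + r ≤ p
    · obtain ⟨y, hy1, hy2, hy3⟩ := exists_mod_eq_of_lt hc (max s (r + 1) - 1)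
      refine ⟨p * k + (y + 1), mem_codingSet_of_period (by omega) (by omega) (by omega) ?_,
        by omega, by omega⟩
      rw [holedWord, if_neg (by omega), Nat.add_sub_cancel, hy3]
    · have hc' := (C (p * (k + 1) + 1)).isLt
      have hmul : p * (k + 1) = p * k + p := by ring
      refine ⟨p * (k + 1) + C (p * (k + 1) + 1),
        mem_codingSet_of_period (by omega) (by omega) (by omega) ?_, by omega, by omega⟩
      rw [holedWord, if_pos hc']

/-- Modulo a prime `p`, a progression of length `p` whose difference is prime to `p` meets every
residue class. -/
theorem exists_add_mul_mod_eq {p : ℕ} (hp : p.Prime) {d : ℕ} (hd : ¬ p ∣ d) (a : ℕ) {t : ℕ}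
    (ht : t < p) : ∃ j < p, (a + j * d) % p = t := by
  have := Fact.mk hp
  have hd0 : (d : ZMod p) ≠ 0 := by rwa [Ne, ZMod.natCast_eq_zero_iff]
  refine ⟨(((t : ZMod p) - a) / d).val, ZMod.val_lt _, ?_⟩
  have h : ((a + (((t : ZMod p) - a) / d).val * d : ℕ) : ZMod p) = (t : ℕ) := by
    push_cast
    rw [ZMod.natCast_zmod_val, div_mul_cancel₀ _ hd0]
    ring
  rw [ZMod.natCast_eq_natCast_iff'] at h
  rw [h, Nat.mod_eq_of_lt ht]

theorem IsRSyndeticLarge.isRLarge {r : ℕ} (hr : 2 ≤ r) {S : Set ℕ}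
    (h : IsRSyndeticLarge (2 * r - 1) S) : IsRLarge r S := by
  intro C ℓ hℓ
  obtain ⟨p, hpr, hp⟩ := Nat.exists_infinite_primes (2 * r + 1)
  obtain ⟨a, d, -, hd, hE⟩ := h (codingSet p C) (fun n hn => hn.1)
    (syndeticConst_codingSet hr hpr C) (ℓ + p) (by omega)
  obtain ⟨e, rfl⟩ : p ∣ d := by
    by_contra hpd
    obtain ⟨j, hj, hjr⟩ := exists_add_mul_mod_eq hp hpd a (show r < p by omega)
    exact (hE j (by omega)).2.1 hjr
  have hcol : ∀ j < ℓ, (C (p * (a / p) + 1 + j * (p * e)) : ℕ) = holedWord r (a % p) := by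
    intro j hj
    have hmem := (hE j (by omega)).2.2
    have he : a + j * (p * e) = a + p * (j * e) := by ring
    rw [he, Nat.add_mul_mod_self_left, Nat.add_mul_div_left _ _ hp.pos] at hmem
    rw [← hmem]
    congr 2
    ring
  refine ⟨p * (a / p) + 1, p * e, by omega, hd, fun j hj => Fin.ext ?_⟩
  rw [hcol j hj, ← hcol 0 (by omega), zero_mul, add_zero]

/-- (i) every `r`-large set is `r`-syndetic large; (ii) every `(2r-1)`-syndetic large set is
`r`-large. -/
theorem rLarge_syndeticLarge (r : ℕ) (hr : 2 ≤ r) (S : Set ℕ) (hS : ∀ n ∈ S, 1 ≤ n) :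
    (IsRLarge r S → IsRSyndeticLarge r S) ∧
    (IsRSyndeticLarge (2 * r - 1) S → IsRLarge r S) := by
  exact ⟨IsRLarge.isRSyndeticLarge (by omega), IsRSyndeticLarge.isRLarge hr⟩
end
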